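/- Let (W,S) be the Coxeter system of type F_4: S = {1,2,3,4} with m(1,2) = 3, m(2,3) = 4, m(3,4) = 3 and all other pairs commuting (m = 2). Then the homology of the weighted complex C_*(W) is: H_0 ≅ R/(Φ_2); H_1 ≅ R/(Φ_2); H_2 ≅ R/(Φ_2) ⊕ R/(Φ_3) ⊕ R/(Φ_6); H_3 ≅ R/(Φ_2) ⊕ R/(Φ_3) ⊕ R/(Φ_4) ⊕ R/(Φ_6) ⊕ R/(Φ_8) ⊕ R/(Φ_12); and H_k = 0 for all k ≥ 4. -/

import Mathlib

open Polynomial CoxeterSystem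

set_option synthInstance.maxHeartbeats 1000000
set_option maxHeartbeats 1000000

noncomputable section

/-- The ring `R = ℚ[q,q⁻¹]` of Laurent polynomials over `ℚ`. -/
abbrev R : Type := LaurentPolynomial ℚ

/-- The image of the `d`-th cyclotomic polynomial `Φ_d` in `R`. -/
def cyc (d : ℕ) : R := Polynomial.toLaurent (Polynomial.cyclotomic d ℚ)

/-- The `R`-module `R/(Φ_d)`. -/
abbrev CycQuot (d : ℕ) := R ⧸ Ideal.span {cyc d}

variable {B : Type*} [Fintype B] [LinearOrder B] {W : Type*} [Group W]
  {M : CoxeterMatrix B} (cs : CoxeterSystem M W)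

/-- The standard parabolic subgroup `W_σ` generated by `σ ⊆ S`. -/
def parabolic (σ : Finset B) : Subgroup W := Subgroup.closure (cs.simple '' σ)

/-- The Poincaré polynomial `W_σ(q) = Σ_{w ∈ W_σ} q^{ℓ(w)}` of the standard parabolic
subgroup `W_σ` (defined to be `0` if `W_σ` is infinite). -/
def poin (σ : Finset B) : ℚ[X] :=
  letI := Classical.dec ((parabolic cs σ : Set W).Finite)
  if h : (parabolic cs σ : Set W).Finite then ∑ w ∈ h.toFinset, X ^ cs.length w else 0

/-- The set of simplices `σ ∈ K_W` with `|σ| = k`, i.e. the subsets of `S` of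
cardinality `k` generating a finite standard parabolic subgroup. -/
abbrev KW (k : ℕ) := {σ : Finset B // σ.card = k ∧ (parabolic cs σ : Set W).Finite}

noncomputable instance (k : ℕ) : Fintype (KW cs k) := Fintype.ofFinite _

/-- The coefficient of `e_τ` in `∂ e_σ`: it is
`(−1)^{#{t ∈ σ : t < s}} · W_σ(q)/W_{σ∖{s}}(q)` if `τ = σ ∖ {s}` for some `s ∈ σ`,
and `0` otherwise. -/
def bcoeff (σ τ : Finset B) : R :=
  ∑ s ∈ σ, if τ = σ.erase s then
      (-1 : R) ^ (σ.filter (fun t => t < s)).card *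
        Polynomial.toLaurent (poin cs σ / poin cs τ)
    else 0

/-- The boundary map `∂ : C_{k+1} → C_k` of the weighted complex `C_*(W)`, where
`C_k = ⊕_{σ ∈ K_W, |σ| = k} R·e_σ`. -/
def bdry (k : ℕ) : (KW cs (k + 1) → R) →ₗ[R] (KW cs k → R) :=
  Matrix.mulVecLin (Matrix.of fun (τ : KW cs k) (σ : KW cs (k + 1)) => bcoeff cs σ.1 τ.1)

/-- The submodule of cycles in degree `k` of the weighted complex. -/
def cycles : (k : ℕ) → Submodule R (KW cs k → R)
  | 0 => ⊤
  | (k + 1) => LinearMap.ker (bdry cs k)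

/-- The `k`-th homology `H_k(C_*(W))` of the weighted complex: cycles modulo boundaries. -/
abbrev Hgy (k : ℕ) :=
  cycles cs k ⧸ Submodule.comap (cycles cs k).subtype (LinearMap.range (bdry cs k))

end

/-! ### Words and braid moves in type `F₄` -/

/-- The Coxeter matrix of type `F₄`. -/
def coxF4 : Fin 4 → Fin 4 → ℕ :=
  ![![1, 3, 2, 2], ![3, 1, 4, 2], ![2, 4, 1, 3], ![2, 2, 3, 1]]

/-- Apply the braid relation, or the cancellation of two equal letters, at a given position. -/
def braidMove : ℕ → List (Fin 4) → List (Fin 4)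
  | p + 1, a :: w => a :: braidMove p w
  | 0, a :: b :: w =>
    if a = b then w
    else if coxF4 a b = 2 then b :: a :: w
    else match w with
      | c :: w' =>
        if coxF4 a b = 3 ∧ c = a then b :: a :: b :: w'
        else match w' with
          | d :: w'' =>
            if coxF4 a b = 4 ∧ c = a ∧ d = b then b :: a :: b :: a :: w''
            else a :: b :: w
          | _ => a :: b :: w
      | _ => a :: b :: w
  | _, w => w

/-- Apply a sequence of moves `braidMove` at the given positions. -/
def braidMoves (ps : List ℕ) (w : List (Fin 4)) : List (Fin 4) :=
  ps.foldl (fun v p => braidMove p v) w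

section Words

variable {W : Type*} [Group W] {Mat : CoxeterMatrix (Fin 4)} (cs : CoxeterSystem Mat W)

theorem coxF4_braid_two (hM : ∀ i j, Mat.M i j = coxF4 i j) {a b : Fin 4} (h : coxF4 a b = 2) :
    cs.simple a * cs.simple b = cs.simple b * cs.simple a := by
  have := cs.wordProd_braidWord_eq a b
  rw [braidWord, braidWord, Mat.symmetric b a, show Mat a b = 2 from (hM a b).trans h] at this
  simpa [alternatingWord, wordProd] using this

theorem coxF4_braid_three (hM : ∀ i j, Mat.M i j = coxF4 i j) {a b : Fin 4} (h : coxF4 a b = 3) :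
    cs.simple a * (cs.simple b * cs.simple a) = cs.simple b * (cs.simple a * cs.simple b) := by
  have := cs.wordProd_braidWord_eq a b
  rw [braidWord, braidWord, Mat.symmetric b a, show Mat a b = 3 from (hM a b).trans h] at this
  simpa [alternatingWord, wordProd] using this.symm

theorem coxF4_braid_four (hM : ∀ i j, Mat.M i j = coxF4 i j) {a b : Fin 4} (h : coxF4 a b = 4) :
    cs.simple a * (cs.simple b * (cs.simple a * cs.simple b)) =
      cs.simple b * (cs.simple a * (cs.simple b * cs.simple a)) := by
  have := cs.wordProd_braidWord_eq a b
  rw [braidWord, braidWord, Mat.symmetric b a, show Mat a b = 4 from (hM a b).trans h] at this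
  simpa [alternatingWord, wordProd] using this

theorem wordProd_braidMove (hM : ∀ i j, Mat.M i j = coxF4 i j) (p : ℕ) (w : List (Fin 4)) :
    cs.wordProd (braidMove p w) = cs.wordProd w := by
  induction p generalizing w with
  | succ p ih => cases w <;> simp [braidMove, wordProd_cons, ih]
  | zero =>
    unfold braidMove
    split
    · simp_all
    · split_ifs with h1 h2
      · subst h1; simp [wordProd_cons]
      · simp only [wordProd_cons, ← mul_assoc, coxF4_braid_two cs hM h2]
      · split
        · split_ifs with h3
          · obtain ⟨h3, rfl⟩ := h3
            have := coxF4_braid_three cs hM h3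
            simp only [wordProd_cons, ← mul_assoc] at this ⊢
            rw [this]
          · split
            · split_ifs with h4
              · obtain ⟨h4, rfl, rfl⟩ := h4
                have := coxF4_braid_four cs hM h4
                simp only [wordProd_cons, ← mul_assoc] at this ⊢
                rw [this]
              · rfl
            · rfl
        · rfl
    · rfl

theorem wordProd_braidMoves (hM : ∀ i j, Mat.M i j = coxF4 i j) (ps : List ℕ)
    (w : List (Fin 4)) : cs.wordProd (braidMoves ps w) = cs.wordProd w := by
  induction ps generalizing w with
  | nil => rfl
  | cons p ps ih =>
    exact (ih _).trans (wordProd_braidMove cs hM p w)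

/-! ### The reflection representation and inversions -/

/-- The simple reflections of type `F₄`, acting on the weight lattice in the basis of
fundamental weights. -/
def reflF4 : Fin 4 → ℤ × ℤ × ℤ × ℤ → ℤ × ℤ × ℤ × ℤ
  | 0, (a, b, c, d) => (-a, b + a, c, d)
  | 1, (a, b, c, d) => (a + b, -b, c + 2 * b, d)
  | 2, (a, b, c, d) => (a, b + c, -c, d + c)
  | 3, (a, b, c, d) => (a, b, c + d, -d)

/-- The simple reflections of type `F₄`, acting on coroots in the basis of simple coroots. -/
def corootReflF4 : Fin 4 → ℤ × ℤ × ℤ × ℤ → ℤ × ℤ × ℤ × ℤ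
  | 0, (x, y, z, t) => (-x + y, y, z, t)
  | 1, (x, y, z, t) => (x, x - y + 2 * z, z, t)
  | 2, (x, y, z, t) => (x, y, y - z + t, t)
  | 3, (x, y, z, t) => (x, y, z, z - t)

/-- The pairing between coroots and weights. -/
def pairF4 : ℤ × ℤ × ℤ × ℤ → ℤ × ℤ × ℤ × ℤ → ℤ
  | (x, y, z, t), (a, b, c, d) => x * a + y * b + z * c + t * d

theorem pairF4_reflF4 (i : Fin 4) (β v : ℤ × ℤ × ℤ × ℤ) :
    pairF4 β (reflF4 i v) = pairF4 (corootReflF4 i β) v := by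
  obtain ⟨x, y, z, t⟩ := β
  obtain ⟨a, b, c, d⟩ := v
  fin_cases i <;> simp [pairF4, reflF4, corootReflF4] <;> ring

/-- The positive coroots of type `F₄`. -/
def posCorootsF4 : List (ℤ × ℤ × ℤ × ℤ) :=
  [(0, 0, 0, 1), (0, 0, 1, 0), (0, 1, 0, 0), (1, 0, 0, 0), (0, 0, 1, 1), (0, 1, 1, 0),
   (1, 1, 0, 0), (0, 1, 1, 1), (0, 2, 1, 0), (1, 1, 1, 0), (0, 2, 1, 1), (1, 1, 1, 1),
   (1, 2, 1, 0), (0, 2, 2, 1), (1, 2, 1, 1), (2, 2, 1, 0), (1, 2, 2, 1), (2, 2, 1, 1),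
   (1, 3, 2, 1), (2, 2, 2, 1), (2, 3, 2, 1), (2, 4, 2, 1), (2, 4, 3, 1), (2, 4, 3, 2)]

/-- The simple coroots of type `F₄`. -/
def simpleCorootF4 : Fin 4 → ℤ × ℤ × ℤ × ℤ :=
  ![(1, 0, 0, 0), (0, 1, 0, 0), (0, 0, 1, 0), (0, 0, 0, 1)]

/-- The number of positive coroots that are negative on the weight `v`. -/
def invF4 (v : ℤ × ℤ × ℤ × ℤ) : ℕ := posCorootsF4.countP (fun β => pairF4 β v < 0)

theorem corootReflF4_perm (i : Fin 4) :
    (posCorootsF4.map (corootReflF4 i)).Perm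
      (corootReflF4 i (simpleCorootF4 i) :: posCorootsF4.erase (simpleCorootF4 i)) := by
  revert i
  decide +kernel

theorem invF4_reflF4_le (i : Fin 4) (v : ℤ × ℤ × ℤ × ℤ) : invF4 (reflF4 i v) ≤ invF4 v + 1 := by
  have h : invF4 (reflF4 i v) =
      (posCorootsF4.map (corootReflF4 i)).countP (fun β => pairF4 β v < 0) := by
    rw [List.countP_map, invF4]
    congr 1
    funext β
    simp [pairF4_reflF4]
  rw [h, (corootReflF4_perm i).countP_eq, List.countP_cons]
  have h2 := (List.erase_sublist (a := simpleCorootF4 i) (l := posCorootsF4)).countP_le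
    (p := fun β => decide (pairF4 β v < 0))
  unfold invF4
  split_ifs <;> omega

/-- The image of the Weyl vector under the element represented by a word. -/
def weylF4 (w : List (Fin 4)) : ℤ × ℤ × ℤ × ℤ := w.foldr reflF4 (1, 1, 1, 1)

theorem invF4_weylF4_le (w : List (Fin 4)) : invF4 (weylF4 w) ≤ w.length := by
  induction w with
  | nil => decide
  | cons a w ih => exact (invF4_reflF4_le a _).trans (Nat.succ_le_succ ih)

/-- The simple reflections `reflF4` as elements of the endomorphism monoid. -/
def reflEndF4 (i : Fin 4) : Function.End (ℤ × ℤ × ℤ × ℤ) := reflF4 i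

theorem reflEndF4_isLiftable (hM : ∀ i j, Mat.M i j = coxF4 i j) :
    Mat.IsLiftable reflEndF4 := by
  intro i j
  rw [show Mat i j = coxF4 i j from hM i j]
  have h : ∀ n : ℕ, (reflEndF4 i * reflEndF4 j) ^ n = (reflF4 i ∘ reflF4 j)^[n] := by
    intro n
    induction n with
    | zero => rfl
    | succ n ih => rw [pow_succ, ih, Function.iterate_succ]; rfl
  rw [h]
  funext ⟨a, b, c, d⟩
  show _ = (a, b, c, d)
  fin_cases i <;> fin_cases j <;> simp [coxF4, reflF4] <;> grind

/-- The reflection representation of a group of type `F₄`. -/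
def repF4 (hM : ∀ i j, Mat.M i j = coxF4 i j) : W →* Function.End (ℤ × ℤ × ℤ × ℤ) :=
  cs.lift ⟨reflEndF4, reflEndF4_isLiftable hM⟩

theorem repF4_simple_smul (hM : ∀ i j, Mat.M i j = coxF4 i j) (i : Fin 4)
    (v : ℤ × ℤ × ℤ × ℤ) : repF4 cs hM (cs.simple i) • v = reflF4 i v := by
  rw [repF4, cs.lift_apply_simple]
  rfl

theorem repF4_wordProd_smul (hM : ∀ i j, Mat.M i j = coxF4 i j) (w : List (Fin 4))
    (v : ℤ × ℤ × ℤ × ℤ) : repF4 cs hM (cs.wordProd w) • v = w.foldr reflF4 v := by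
  induction w with
  | nil => rw [wordProd_nil, map_one, one_smul]; rfl
  | cons a u ih => rw [wordProd_cons, map_mul, mul_smul, ih, repF4_simple_smul]; rfl

theorem length_wordProd_eq (hM : ∀ i j, Mat.M i j = coxF4 i j) {w : List (Fin 4)}
    (h : invF4 (weylF4 w) = w.length) : cs.length (cs.wordProd w) = w.length := by
  refine le_antisymm (cs.length_wordProd_le w) ?_
  obtain ⟨v, hv, hvw⟩ := cs.exists_isReduced (cs.wordProd w)
  rw [hvw, hv.eq, ← h, weylF4, ← repF4_wordProd_smul cs hM, hvw, repF4_wordProd_smul cs hM]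
  exact invF4_weylF4_le v

/-! ### Normal forms of parabolic subgroups -/

/-- The words in the list `L` represent each element of the parabolic subgroup `W_σ` exactly
once. -/
def Represents (σ : Finset (Fin 4)) (L : List (List (Fin 4))) : Prop :=
  (∀ g : W, g ∈ parabolic cs σ ↔ ∃ w ∈ L, cs.wordProd w = g) ∧ (L.map cs.wordProd).Nodup

theorem represents_empty : Represents cs ∅ [[]] := by
  refine ⟨fun g => ?_, by simp⟩
  simp [parabolic, eq_comm]

/-- All concatenations of a word in `U` with a word in `L`. -/
def concatWords (U L : List (List (Fin 4))) : List (List (Fin 4)) :=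
  U.flatMap fun u => L.map (u ++ ·)

/-- The words in the table `T` represent the cosets of `W_J` in `W_σ`. Each word `u` comes with
sequences of braid moves that bring the word `s :: u`, for `s ∈ σ`, either to another word of the
table or to the form `u ++ [t]` with `t ∈ J`. The cosets are distinguished by their action on the
weight `ω`, which is fixed by `W_J`. -/
def IsCosetTable (σ J : Finset (Fin 4)) (ω : ℤ × ℤ × ℤ × ℤ)
    (T : List (List (Fin 4) × List (List ℕ))) : Prop :=
  J ⊆ σ ∧ [] ∈ T.map Prod.fst ∧ (∀ u ∈ T.map Prod.fst, ∀ a ∈ u, a ∈ σ) ∧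
    (∀ p ∈ T, ∀ s ∈ σ, braidMoves (p.2.getD s []) (s :: p.1) ∈ T.map Prod.fst ∨
      ∃ t ∈ J, braidMoves (p.2.getD s []) (s :: p.1) = p.1 ++ [t]) ∧
    (∀ t ∈ J, reflF4 t ω = ω) ∧ ((T.map Prod.fst).map fun u => u.foldr reflF4 ω).Nodup

instance (σ J : Finset (Fin 4)) (ω : ℤ × ℤ × ℤ × ℤ) (T : List (List (Fin 4) × List (List ℕ))) :
    Decidable (IsCosetTable σ J ω T) := by
  unfold IsCosetTable
  infer_instance

theorem simple_mem_parabolic {σ : Finset (Fin 4)} {s : Fin 4} (hs : s ∈ σ) :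
    cs.simple s ∈ parabolic cs σ :=
  Subgroup.subset_closure ⟨s, hs, rfl⟩

theorem wordProd_mem_parabolic {σ : Finset (Fin 4)} {w : List (Fin 4)} (hw : ∀ a ∈ w, a ∈ σ) :
    cs.wordProd w ∈ parabolic cs σ :=
  Subgroup.list_prod_mem _ (by
    intro x hx
    obtain ⟨a, ha, rfl⟩ := List.mem_map.1 hx
    exact simple_mem_parabolic cs (hw a ha))

theorem repF4_smul_eq_of_mem_parabolic (hM : ∀ i j, Mat.M i j = coxF4 i j) {J : Finset (Fin 4)}
    {ω : ℤ × ℤ × ℤ × ℤ} (hω : ∀ t ∈ J, reflF4 t ω = ω) {x : W} (hx : x ∈ parabolic cs J) :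
    repF4 cs hM x • ω = ω := by
  induction hx using Subgroup.closure_induction_left with
  | one => rw [map_one, one_smul]
  | mul_left x hx y _ ih =>
    obtain ⟨s, hs, rfl⟩ := hx
    rw [map_mul, mul_smul, ih, repF4_simple_smul, hω s hs]
  | inv_mul_cancel x hx y _ ih =>
    obtain ⟨s, hs, rfl⟩ := hx
    rw [inv_simple, map_mul, mul_smul, ih, repF4_simple_smul, hω s hs]

theorem Represents.concatWords (hM : ∀ i j, Mat.M i j = coxF4 i j) {σ J : Finset (Fin 4)}
    {L : List (List (Fin 4))} (hL : Represents cs J L) (ω : ℤ × ℤ × ℤ × ℤ)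
    {T : List (List (Fin 4) × List (List ℕ))} (hT : IsCosetTable σ J ω T) :
    Represents cs σ (concatWords (T.map Prod.fst) L) := by
  obtain ⟨hJ, hnil, hmem, hmul, hω, hnd⟩ := hT
  set U := T.map Prod.fst with hU
  have hset : ∀ g, (∃ w ∈ _root_.concatWords U L, cs.wordProd w = g) ↔
      ∃ u ∈ U, ∃ x ∈ parabolic cs J, cs.wordProd u * x = g := by
    intro g
    constructor
    · rintro ⟨w, hw, rfl⟩
      obtain ⟨u, hu, hw⟩ := List.mem_flatMap.1 hw
      obtain ⟨v, hv, rfl⟩ := List.mem_map.1 hw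
      exact ⟨u, hu, _, (hL.1 _).2 ⟨v, hv, rfl⟩, (cs.wordProd_append u v).symm⟩
    · rintro ⟨u, hu, x, hx, rfl⟩
      obtain ⟨v, hv, rfl⟩ := (hL.1 _).1 hx
      exact ⟨u ++ v, List.mem_flatMap.2 ⟨u, hu, List.mem_map.2 ⟨v, hv, rfl⟩⟩,
        cs.wordProd_append u v⟩
  refine ⟨fun g => ?_, ?_⟩
  · rw [hset]
    constructor
    · have hstep : ∀ s ∈ σ, ∀ g, (∃ u ∈ U, ∃ x ∈ parabolic cs J, cs.wordProd u * x = g) →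
          ∃ u ∈ U, ∃ x ∈ parabolic cs J, cs.wordProd u * x = cs.simple s * g := by
        rintro s hs _ ⟨u, hu, x, hx, rfl⟩
        obtain ⟨p, hp, rfl⟩ := List.mem_map.1 hu
        obtain h | ⟨t, ht, h⟩ := hmul p hp s hs
        · refine ⟨_, h, x, hx, ?_⟩
          rw [wordProd_braidMoves cs hM, wordProd_cons, mul_assoc]
        · refine ⟨p.1, hu, cs.simple t * x, mul_mem (simple_mem_parabolic cs ht) hx, ?_⟩
          rw [← mul_assoc, ← mul_assoc, ← wordProd_cons,
            ← wordProd_braidMoves cs hM (p.2.getD s []) (s :: p.1), h, wordProd_append,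
            wordProd_singleton]
      intro hg
      induction hg using Subgroup.closure_induction_left with
      | one => exact ⟨[], hnil, 1, one_mem _, by simp⟩
      | mul_left x hx y _ ih =>
        obtain ⟨s, hs, rfl⟩ := hx
        exact hstep s hs y ih
      | inv_mul_cancel x hx y _ ih =>
        obtain ⟨s, hs, rfl⟩ := hx
        rw [inv_simple]
        exact hstep s hs y ih
    · rintro ⟨u, hu, x, hx, rfl⟩
      exact mul_mem (wordProd_mem_parabolic cs (hmem u hu))
        (Subgroup.closure_mono (Set.image_mono (Finset.coe_subset.2 hJ)) hx)
  · rw [_root_.concatWords, List.map_flatMap, List.nodup_flatMap]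
    constructor
    · intro u _
      have := hL.2.map (mul_right_injective (cs.wordProd u))
      simpa [Function.comp_def, wordProd_append] using this
    · rw [List.Nodup, List.pairwise_map] at hnd
      refine hnd.imp fun {u u'} hne => ?_
      rw [Function.onFun, List.disjoint_left]
      intro g hg hg'
      simp only [List.mem_map, exists_exists_and_eq_and] at hg hg'
      obtain ⟨v, hv, rfl⟩ := hg
      obtain ⟨v', hv', h⟩ := hg'
      have key : ∀ a, ∀ b ∈ L,
          repF4 cs hM (cs.wordProd (a ++ b)) • ω = a.foldr reflF4 ω := by
        intro a b hb
        rw [wordProd_append, map_mul, mul_smul,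
          repF4_smul_eq_of_mem_parabolic cs hM hω ((hL.1 _).2 ⟨b, hb, rfl⟩),
          repF4_wordProd_smul]
      exact hne (by rw [← key u v hv, ← key u' v' hv', h])

/-- The generating function of a list of words with respect to length. -/
noncomputable def lengthPoly (L : List (List (Fin 4))) : ℚ[X] :=
  (L.map fun w => (X : ℚ[X]) ^ w.length).sum

theorem lengthPoly_concatWords (U L : List (List (Fin 4))) :
    lengthPoly (concatWords U L) = lengthPoly U * lengthPoly L := by
  induction U with
  | nil => simp [concatWords, lengthPoly]
  | cons u U ih =>
    simp only [lengthPoly, concatWords, List.flatMap_cons, List.map_append, List.sum_append,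
      List.map_map, List.map_cons, List.sum_cons, add_mul] at ih ⊢
    rw [ih]
    simp [Function.comp_def, pow_add, List.sum_map_mul_left]

theorem Represents.finite {σ : Finset (Fin 4)} {L : List (List (Fin 4))}
    (hL : Represents cs σ L) : (parabolic cs σ : Set W).Finite := by
  refine (L.map cs.wordProd).finite_toSet.subset fun g hg => ?_
  obtain ⟨w, hw, rfl⟩ := (hL.1 g).1 hg
  exact List.mem_map.2 ⟨w, hw, rfl⟩

theorem Represents.toFinset_eq [DecidableEq W] {σ : Finset (Fin 4)} {L : List (List (Fin 4))}
    (hL : Represents cs σ L) : (hL.finite cs).toFinset = (L.map cs.wordProd).toFinset := by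
  ext g
  simpa using hL.1 g

/-- If the average length of the words in `L` is half the length of an element of `W_σ`, then all
words in `L` are reduced. -/
theorem Represents.length_eq {σ : Finset (Fin 4)} {L : List (List (Fin 4))}
    (hL : Represents cs σ L) {x : W} (hx : x ∈ parabolic cs σ)
    (hsum : 2 * (L.map List.length).sum = cs.length x * L.length) :
    ∀ w ∈ L, cs.length (cs.wordProd w) = w.length := by
  classical
  have htr : ∀ f : W → ℕ,
      ∑ g ∈ (hL.finite cs).toFinset, f g = (L.map fun w => f (cs.wordProd w)).sum := by
    intro f
    rw [hL.toFinset_eq, List.sum_toFinset _ hL.2, List.map_map]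
    rfl
  have hinv : ∑ g ∈ (hL.finite cs).toFinset, cs.length (g⁻¹ * x) =
      ∑ g ∈ (hL.finite cs).toFinset, cs.length g := by
    refine Finset.sum_equiv ((Equiv.inv W).trans (Equiv.mulRight x)) (fun g => ?_) (by simp)
    simp [(parabolic cs σ).mul_mem_cancel_right hx]
  have hle : ∑ g ∈ (hL.finite cs).toFinset, cs.length x ≤
      ∑ g ∈ (hL.finite cs).toFinset, (cs.length g + cs.length (g⁻¹ * x)) := by
    refine Finset.sum_le_sum fun g _ => ?_
    simpa using cs.length_mul_le g (g⁻¹ * x)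
  rw [Finset.sum_add_distrib, hinv, htr, htr] at hle
  simp only [List.map_const', List.sum_replicate, smul_eq_mul] at hle
  have hle2 : ∀ K : List (List (Fin 4)),
      (K.map fun w => cs.length (cs.wordProd w)).sum ≤ (K.map List.length).sum :=
    fun K => List.sum_le_sum fun w _ => cs.length_wordProd_le w
  intro w hw
  refine le_antisymm (cs.length_wordProd_le w) ?_
  by_contra! hlt
  have := List.sum_lt_sum (l := L) (fun w => cs.length (cs.wordProd w)) List.length
    (fun w _ => cs.length_wordProd_le w) ⟨w, hw, hlt⟩
  lia

theorem Represents.poin_eq (hM : ∀ i j, Mat.M i j = coxF4 i j) {σ : Finset (Fin 4)}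
    {L : List (List (Fin 4))} (hL : Represents cs σ L) (w₀ : List (Fin 4))
    (hmem : ∀ a ∈ w₀, a ∈ σ) (hinv : invF4 (weylF4 w₀) = w₀.length)
    (hsum : 2 * (L.map List.length).sum = w₀.length * L.length) :
    poin cs σ = lengthPoly L := by
  classical
  have hlen := hL.length_eq cs (wordProd_mem_parabolic cs hmem)
    (by rw [length_wordProd_eq cs hM hinv, hsum])
  rw [poin, dif_pos (hL.finite cs), lengthPoly, hL.toFinset_eq, List.sum_toFinset _ hL.2,
    List.map_map]
  congr 1
  refine List.map_congr_left fun w hw => ?_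
  simp [hlen w hw]

end Words

section Parabolics

variable {W : Type*} [Group W] {Mat : CoxeterMatrix (Fin 4)} (cs : CoxeterSystem Mat W)

theorem two_mul_sum_length_concatWords {U L : List (List (Fin 4))} {m n : ℕ}
    (hU : 2 * (U.map List.length).sum = m * U.length)
    (hL : 2 * (L.map List.length).sum = n * L.length) :
    2 * ((concatWords U L).map List.length).sum = (m + n) * (concatWords U L).length := by
  have h1 : ((concatWords U L).map List.length).sum =
      (U.map List.length).sum * L.length + U.length * (L.map List.length).sum := by
    clear hU
    induction U with
    | nil => simp [concatWords]
    | cons u U ih =>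
      simp only [concatWords, List.flatMap_cons, List.map_append, List.sum_append] at ih ⊢
      rw [ih]
      simp [Function.comp_def, List.sum_map_add]
      ring
  have h2 : (concatWords U L).length = U.length * L.length := by
    simp [concatWords, List.length_flatMap]
  rw [h1, h2]
  linear_combination L.length * hU + U.length * hL

/-- The polynomial `P` is the length generating function of a list of words that represents each
element of `W_σ` once and whose average length is half the length of the reduced word `w₀`. -/
def HasGrowth (σ : Finset (Fin 4)) (w₀ : List (Fin 4)) (P : ℚ[X]) : Prop :=
  ∃ L, Represents cs σ L ∧ (∀ a ∈ w₀, a ∈ σ) ∧ invF4 (weylF4 w₀) = w₀.length ∧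
    2 * (L.map List.length).sum = w₀.length * L.length ∧ P = lengthPoly L

theorem hasGrowth_empty : HasGrowth cs ∅ [] 1 :=
  ⟨[[]], represents_empty cs, by simp, by decide, by simp, by simp [lengthPoly]⟩

theorem HasGrowth.poin_eq (hM : ∀ i j, Mat.M i j = coxF4 i j) {σ : Finset (Fin 4)}
    {w₀ : List (Fin 4)} {P : ℚ[X]} (h : HasGrowth cs σ w₀ P) : poin cs σ = P := by
  obtain ⟨L, hL, h1, h2, h3, rfl⟩ := h
  exact hL.poin_eq cs hM w₀ h1 h2 h3

theorem HasGrowth.extend (hM : ∀ i j, Mat.M i j = coxF4 i j) {σ J : Finset (Fin 4)}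
    {w₀ : List (Fin 4)} {P : ℚ[X]} (h : HasGrowth cs J w₀ P) (ω : ℤ × ℤ × ℤ × ℤ)
    (u : List (Fin 4)) {T : List (List (Fin 4) × List (List ℕ))}
    (hT : IsCosetTable σ J ω T ∧ u ∈ T.map Prod.fst ∧
      invF4 (weylF4 (u ++ w₀)) = (u ++ w₀).length ∧
      2 * ((T.map Prod.fst).map List.length).sum = u.length * (T.map Prod.fst).length) :
    HasGrowth cs σ (u ++ w₀) (lengthPoly (T.map Prod.fst) * P) := by
  obtain ⟨hT, hu, hinv, hsum⟩ := hT
  obtain ⟨L, hL, h1, h2, h3, rfl⟩ := h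
  refine ⟨concatWords (T.map Prod.fst) L, hL.concatWords cs hM ω hT, fun a ha => ?_, hinv, ?_,
    (lengthPoly_concatWords _ _).symm⟩
  · rcases List.mem_append.1 ha with ha | ha
    · exact hT.2.2.1 u hu a ha
    · exact hT.1 (h1 a ha)
  · rw [List.length_append]
    exact two_mul_sum_length_concatWords hsum h3

/-- The coset table for `W_∅` in `W_{0}`. -/
def cosetTable0 : List (List (Fin 4) × List (List ℕ)) :=
  [([], []), ([0], [[0]])]

theorem hasGrowth_0 (hM : ∀ i j, Mat.M i j = coxF4 i j) :
    HasGrowth cs {0} [0]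
      (1 + X) := by
  have h := (hasGrowth_empty cs).extend cs hM (1, 0, 0, 0)
    [0] (σ := {0}) (T := cosetTable0) (by decide +kernel)
  have hP : lengthPoly (cosetTable0.map Prod.fst) =
      1 + X := by
    simp [lengthPoly, cosetTable0]
  rw [hP, mul_one] at h
  exact h

/-- The coset table for `W_∅` in `W_{1}`. -/
def cosetTable1 : List (List (Fin 4) × List (List ℕ)) :=
  [([], []), ([1], [[], [0]])]

theorem hasGrowth_1 (hM : ∀ i j, Mat.M i j = coxF4 i j) :
    HasGrowth cs {1} [1]
      (1 + X) := by
  have h := (hasGrowth_empty cs).extend cs hM (0, 1, 0, 0)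
    [1] (σ := {1}) (T := cosetTable1) (by decide +kernel)
  have hP : lengthPoly (cosetTable1.map Prod.fst) =
      1 + X := by
    simp [lengthPoly, cosetTable1]
  rw [hP, mul_one] at h
  exact h

/-- The coset table for `W_∅` in `W_{2}`. -/
def cosetTable2 : List (List (Fin 4) × List (List ℕ)) :=
  [([], []), ([2], [[], [], [0]])]

theorem hasGrowth_2 (hM : ∀ i j, Mat.M i j = coxF4 i j) :
    HasGrowth cs {2} [2]
      (1 + X) := by
  have h := (hasGrowth_empty cs).extend cs hM (0, 0, 1, 0)
    [2] (σ := {2}) (T := cosetTable2) (by decide +kernel)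
  have hP : lengthPoly (cosetTable2.map Prod.fst) =
      1 + X := by
    simp [lengthPoly, cosetTable2]
  rw [hP, mul_one] at h
  exact h

/-- The coset table for `W_∅` in `W_{3}`. -/
def cosetTable3 : List (List (Fin 4) × List (List ℕ)) :=
  [([], []), ([3], [[], [], [], [0]])]

theorem hasGrowth_3 (hM : ∀ i j, Mat.M i j = coxF4 i j) :
    HasGrowth cs {3} [3]
      (1 + X) := by
  have h := (hasGrowth_empty cs).extend cs hM (0, 0, 0, 1)
    [3] (σ := {3}) (T := cosetTable3) (by decide +kernel)
  have hP : lengthPoly (cosetTable3.map Prod.fst) =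
      1 + X := by
    simp [lengthPoly, cosetTable3]
  rw [hP, mul_one] at h
  exact h

/-- The coset table for `W_{0}` in `W_{0, 1}`. -/
def cosetTable01 : List (List (Fin 4) × List (List ℕ)) :=
  [([], []), ([1], [[], [0]]), ([0, 1], [[0], [0]])]

theorem hasGrowth_01 (hM : ∀ i j, Mat.M i j = coxF4 i j) :
    HasGrowth cs {0, 1} [0, 1, 0]
      ((1 + X + X ^ 2) * (1 + X)) := by
  have h := (hasGrowth_0 cs hM).extend cs hM (0, 1, 0, 0)
    [0, 1] (σ := {0, 1}) (T := cosetTable01) (by decide +kernel)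
  have hP : lengthPoly (cosetTable01.map Prod.fst) =
      1 + X + X ^ 2 := by
    simp [lengthPoly, cosetTable01]
    ring
  rw [hP] at h
  exact h

/-- The coset table for `W_{1}` in `W_{1, 2}`. -/
def cosetTable12 : List (List (Fin 4) × List (List ℕ)) :=
  [([], []), ([2], [[], [], [0]]), ([1, 2], [[], [0]]), ([2, 1, 2], [[], [0], [0]])]

theorem hasGrowth_12 (hM : ∀ i j, Mat.M i j = coxF4 i j) :
    HasGrowth cs {1, 2} [2, 1, 2, 1]
      ((1 + X + X ^ 2 + X ^ 3) * (1 + X)) := by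
  have h := (hasGrowth_1 cs hM).extend cs hM (0, 0, 1, 0)
    [2, 1, 2] (σ := {1, 2}) (T := cosetTable12) (by decide +kernel)
  have hP : lengthPoly (cosetTable12.map Prod.fst) =
      1 + X + X ^ 2 + X ^ 3 := by
    simp [lengthPoly, cosetTable12]
    ring
  rw [hP] at h
  exact h

/-- The coset table for `W_{2}` in `W_{2, 3}`. -/
def cosetTable23 : List (List (Fin 4) × List (List ℕ)) :=
  [([], []), ([3], [[], [], [], [0]]), ([2, 3], [[], [], [0], [0]])]

theorem hasGrowth_23 (hM : ∀ i j, Mat.M i j = coxF4 i j) :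
    HasGrowth cs {2, 3} [2, 3, 2]
      ((1 + X + X ^ 2) * (1 + X)) := by
  have h := (hasGrowth_2 cs hM).extend cs hM (0, 0, 0, 1)
    [2, 3] (σ := {2, 3}) (T := cosetTable23) (by decide +kernel)
  have hP : lengthPoly (cosetTable23.map Prod.fst) =
      1 + X + X ^ 2 := by
    simp [lengthPoly, cosetTable23]
    ring
  rw [hP] at h
  exact h

/-- The coset table for `W_{0}` in `W_{0, 2}`. -/
def cosetTable02 : List (List (Fin 4) × List (List ℕ)) :=
  [([], []), ([2], [[0], [], [0]])]

theorem hasGrowth_02 (hM : ∀ i j, Mat.M i j = coxF4 i j) :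
    HasGrowth cs {0, 2} [2, 0]
      ((1 + X) * (1 + X)) := by
  have h := (hasGrowth_0 cs hM).extend cs hM (0, 0, 1, 0)
    [2] (σ := {0, 2}) (T := cosetTable02) (by decide +kernel)
  have hP : lengthPoly (cosetTable02.map Prod.fst) =
      1 + X := by
    simp [lengthPoly, cosetTable02]
  rw [hP] at h
  exact h

/-- The coset table for `W_{0}` in `W_{0, 3}`. -/
def cosetTable03 : List (List (Fin 4) × List (List ℕ)) :=
  [([], []), ([3], [[0], [], [], [0]])]

theorem hasGrowth_03 (hM : ∀ i j, Mat.M i j = coxF4 i j) :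
    HasGrowth cs {0, 3} [3, 0]
      ((1 + X) * (1 + X)) := by
  have h := (hasGrowth_0 cs hM).extend cs hM (0, 0, 0, 1)
    [3] (σ := {0, 3}) (T := cosetTable03) (by decide +kernel)
  have hP : lengthPoly (cosetTable03.map Prod.fst) =
      1 + X := by
    simp [lengthPoly, cosetTable03]
  rw [hP] at h
  exact h

/-- The coset table for `W_{1}` in `W_{1, 3}`. -/
def cosetTable13 : List (List (Fin 4) × List (List ℕ)) :=
  [([], []), ([3], [[], [0], [], [0]])]

theorem hasGrowth_13 (hM : ∀ i j, Mat.M i j = coxF4 i j) :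
    HasGrowth cs {1, 3} [3, 1]
      ((1 + X) * (1 + X)) := by
  have h := (hasGrowth_1 cs hM).extend cs hM (0, 0, 0, 1)
    [3] (σ := {1, 3}) (T := cosetTable13) (by decide +kernel)
  have hP : lengthPoly (cosetTable13.map Prod.fst) =
      1 + X := by
    simp [lengthPoly, cosetTable13]
  rw [hP] at h
  exact h

/-- The coset table for `W_{1, 2}` in `W_{0, 1, 2}`. -/
def cosetTable012 : List (List (Fin 4) × List (List ℕ)) :=
  [([], []), ([0], [[0], [], [0]]), ([1, 0], [[0], [0]]), ([2, 1, 0], [[0, 1], [], [0]]),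
   ([1, 2, 1, 0], [[], [0], [0, 3]]), ([0, 1, 2, 1, 0], [[0], [0, 2, 3], [0, 1, 4]])]

theorem hasGrowth_012 (hM : ∀ i j, Mat.M i j = coxF4 i j) :
    HasGrowth cs {0, 1, 2} [0, 1, 2, 1, 0, 2, 1, 2, 1]
      ((1 + X + X ^ 2 + X ^ 3 + X ^ 4 + X ^ 5) * ((1 + X + X ^ 2 + X ^ 3) * (1 + X))) := by
  have h := (hasGrowth_12 cs hM).extend cs hM (1, 0, 0, 0)
    [0, 1, 2, 1, 0] (σ := {0, 1, 2}) (T := cosetTable012) (by decide +kernel)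
  have hP : lengthPoly (cosetTable012.map Prod.fst) =
      1 + X + X ^ 2 + X ^ 3 + X ^ 4 + X ^ 5 := by
    simp [lengthPoly, cosetTable012]
    ring
  rw [hP] at h
  exact h

/-- The coset table for `W_{1, 2}` in `W_{1, 2, 3}`. -/
def cosetTable123 : List (List (Fin 4) × List (List ℕ)) :=
  [([], []), ([3], [[], [0], [], [0]]), ([2, 3], [[], [], [0], [0]]),
   ([1, 2, 3], [[], [0], [], [0, 1]]), ([2, 1, 2, 3], [[], [0, 3], [0]]),
   ([3, 2, 1, 2, 3], [[], [0, 1, 4], [0, 2, 3], [0]])]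

theorem hasGrowth_123 (hM : ∀ i j, Mat.M i j = coxF4 i j) :
    HasGrowth cs {1, 2, 3} [3, 2, 1, 2, 3, 2, 1, 2, 1]
      ((1 + X + X ^ 2 + X ^ 3 + X ^ 4 + X ^ 5) * ((1 + X + X ^ 2 + X ^ 3) * (1 + X))) := by
  have h := (hasGrowth_12 cs hM).extend cs hM (0, 0, 0, 1)
    [3, 2, 1, 2, 3] (σ := {1, 2, 3}) (T := cosetTable123) (by decide +kernel)
  have hP : lengthPoly (cosetTable123.map Prod.fst) =
      1 + X + X ^ 2 + X ^ 3 + X ^ 4 + X ^ 5 := by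
    simp [lengthPoly, cosetTable123]
    ring
  rw [hP] at h
  exact h

/-- The coset table for `W_{0, 1}` in `W_{0, 1, 3}`. -/
def cosetTable013 : List (List (Fin 4) × List (List ℕ)) :=
  [([], []), ([3], [[0], [0], [], [0]])]

theorem hasGrowth_013 (hM : ∀ i j, Mat.M i j = coxF4 i j) :
    HasGrowth cs {0, 1, 3} [3, 0, 1, 0]
      ((1 + X) * ((1 + X + X ^ 2) * (1 + X))) := by
  have h := (hasGrowth_01 cs hM).extend cs hM (0, 0, 0, 1)
    [3] (σ := {0, 1, 3}) (T := cosetTable013) (by decide +kernel)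
  have hP : lengthPoly (cosetTable013.map Prod.fst) =
      1 + X := by
    simp [lengthPoly, cosetTable013]
  rw [hP] at h
  exact h

/-- The coset table for `W_{2, 3}` in `W_{0, 2, 3}`. -/
def cosetTable023 : List (List (Fin 4) × List (List ℕ)) :=
  [([], []), ([0], [[0], [], [0], [0]])]

theorem hasGrowth_023 (hM : ∀ i j, Mat.M i j = coxF4 i j) :
    HasGrowth cs {0, 2, 3} [0, 2, 3, 2]
      ((1 + X) * ((1 + X + X ^ 2) * (1 + X))) := by
  have h := (hasGrowth_23 cs hM).extend cs hM (1, 0, 0, 0)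
    [0] (σ := {0, 2, 3}) (T := cosetTable023) (by decide +kernel)
  have hP : lengthPoly (cosetTable023.map Prod.fst) =
      1 + X := by
    simp [lengthPoly, cosetTable023]
  rw [hP] at h
  exact h

/-- The coset table for `W_{0, 1, 2}` in `W_{0, 1, 2, 3}`. -/
def cosetTable0123 : List (List (Fin 4) × List (List ℕ)) :=
  [([], []), ([3], [[0], [0], [], [0]]), ([2, 3], [[0, 1], [], [0], [0]]),
   ([1, 2, 3], [[], [0], [], [0, 1]]), ([0, 1, 2, 3], [[0], [0, 2, 3], [], [0, 1, 2]]),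
   ([2, 1, 2, 3], [[0], [0, 3], [0]]), ([2, 0, 1, 2, 3], [[0, 1], [], [0]]),
   ([3, 2, 1, 2, 3], [[0, 1], [0, 1, 4], [0, 2, 3], [0]]),
   ([1, 2, 0, 1, 2, 3], [[2, 0, 2, 1, 5], [0]]),
   ([3, 2, 0, 1, 2, 3], [[0, 1, 2], [0], [0, 2, 3, 4], [0]]),
   ([2, 1, 2, 0, 1, 2, 3], [[0, 3, 1, 3, 2, 6], [0, 3, 5, 6], [0]]),
   ([3, 1, 2, 0, 1, 2, 3], [[0, 3, 1, 3, 2, 6], [0, 1], [], [0]]),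
   ([3, 2, 1, 2, 0, 1, 2, 3], [[0, 1, 4, 2, 4, 3, 7], [0, 1, 4, 6, 7], [], [0]]),
   ([2, 3, 1, 2, 0, 1, 2, 3], [[0, 1, 4, 2, 4, 3, 7], [], [0], [0]]),
   ([2, 3, 2, 1, 2, 0, 1, 2, 3], [[0, 1, 2, 5, 3, 5, 4, 8], [], [0], [0, 2]]),
   ([1, 2, 3, 1, 2, 0, 1, 2, 3], [[], [0], [3, 0, 3, 2, 5, 6, 7], [0, 1]]),
   ([1, 2, 3, 2, 1, 2, 0, 1, 2, 3], [[], [0], [], [0, 1, 3]]), ([0, 1, 2, 3, 1, 2, 0, 1, 2, 3],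
   [[0], [0, 2, 3, 6, 4, 6, 5, 9], [0, 4, 1, 4, 3, 6, 7, 8], [0, 1, 2]]),
   ([0, 1, 2, 3, 2, 1, 2, 0, 1, 2, 3], [[0], [0, 2, 3, 4, 7, 5, 7, 6, 10], [], [0, 1, 2, 4]]),
   ([2, 1, 2, 3, 2, 1, 2, 0, 1, 2, 3], [[0], [0, 3, 4, 7, 9, 10], [0],
   [3, 2, 0, 5, 2, 1, 5, 4, 2, 7, 8, 9]]), ([2, 0, 1, 2, 3, 2, 1, 2, 0, 1, 2, 3], [[0, 1], [], [0],
   [1, 0, 4, 3, 1, 0, 6, 3, 2, 6, 5, 3, 8, 9, 10]]), ([1, 2, 0, 1, 2, 3, 2, 1, 2, 0, 1, 2, 3],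
   [[2, 0, 2, 1, 5, 6, 9, 11, 12], [0], [], [0, 2, 1, 5, 4, 2, 1, 7, 4, 3, 7, 6, 4, 9, 10, 11]]),
   ([2, 1, 2, 0, 1, 2, 3, 2, 1, 2, 0, 1, 2, 3], [[0, 3, 1, 3, 2, 6, 7, 10, 12, 13],
   [0, 3, 5, 6, 7, 10, 8, 10, 9, 13], [0]]), ([3, 2, 1, 2, 0, 1, 2, 3, 2, 1, 2, 0, 1, 2, 3],
   [[0, 1, 4, 2, 4, 3, 7, 8, 11, 13, 14], [0, 1, 4, 6, 7, 8, 11, 9, 11, 10, 14],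
   [0, 2, 4, 3, 7, 6, 4, 3, 9, 6, 5, 9, 8, 6, 11, 12, 13], [0]])]

theorem hasGrowth_0123 (hM : ∀ i j, Mat.M i j = coxF4 i j) :
    HasGrowth cs {0, 1, 2, 3} [3, 2, 1, 2, 0, 1, 2, 3, 2, 1, 2, 0, 1, 2, 3, 0, 1, 2, 1,
        0, 2, 1, 2, 1]
      ((1 + X + X ^ 2 + X ^ 3 + 2 * X ^ 4 + 2 * X ^ 5 + 2 * X ^ 6 + 2 * X ^ 7 + 2 * X ^ 8 +
        2 * X ^ 9 + 2 * X ^ 10 + 2 * X ^ 11 + X ^ 12 + X ^ 13 + X ^ 14 + X ^ 15) * ((1 + X +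
        X ^ 2 + X ^ 3 + X ^ 4 + X ^ 5) * ((1 + X + X ^ 2 + X ^ 3) * (1 + X)))) := by
  have h := (hasGrowth_012 cs hM).extend cs hM (0, 0, 0, 1)
    [3, 2, 1, 2, 0, 1, 2, 3, 2, 1, 2, 0, 1, 2, 3]
    (σ := {0, 1, 2, 3}) (T := cosetTable0123) (by decide +kernel)
  have hP : lengthPoly (cosetTable0123.map Prod.fst) =
      1 + X + X ^ 2 + X ^ 3 + 2 * X ^ 4 + 2 * X ^ 5 + 2 * X ^ 6 + 2 * X ^ 7 + 2 * X ^ 8 +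
        2 * X ^ 9 + 2 * X ^ 10 + 2 * X ^ 11 + X ^ 12 + X ^ 13 + X ^ 14 + X ^ 15 := by
    simp [lengthPoly, cosetTable0123]
    ring
  rw [hP] at h
  exact h

end Parabolics

/-! ### Coordinates on the weighted complex -/

section Coordinates

variable {W : Type*} [Group W] {Mat : CoxeterMatrix (Fin 4)} (cs : CoxeterSystem Mat W)

theorem HasGrowth.finite {σ : Finset (Fin 4)} {w₀ : List (Fin 4)} {P : ℚ[X]}
    (h : HasGrowth cs σ w₀ P) : (parabolic cs σ : Set W).Finite := by
  obtain ⟨L, hL, -⟩ := h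
  exact hL.finite cs

theorem HasGrowth.ne_zero {σ : Finset (Fin 4)} {w₀ : List (Fin 4)} {P : ℚ[X]}
    (h : HasGrowth cs σ w₀ P) : P ≠ 0 := by
  obtain ⟨L, hL, -, -, -, rfl⟩ := h
  obtain ⟨w, hw, -⟩ := (hL.1 1).1 (one_mem _)
  intro h0
  have h1 : (lengthPoly L).eval 1 = L.length := by
    rw [lengthPoly, ← Polynomial.coe_evalRingHom, map_list_sum, List.map_map]
    simp [Function.comp_def]
  rw [h0, Polynomial.eval_zero, eq_comm, Nat.cast_eq_zero, List.length_eq_zero_iff] at h1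
  simp [h1] at hw

theorem HasGrowth.poin_div (hM : ∀ i j, Mat.M i j = coxF4 i j) {σ τ : Finset (Fin 4)}
    {u v : List (Fin 4)} {P Q : ℚ[X]} (hσ : HasGrowth cs σ u P) (hτ : HasGrowth cs τ v Q)
    (c : ℚ[X]) (hc : P = c * Q) : poin cs σ / poin cs τ = c := by
  rw [hσ.poin_eq cs hM, hτ.poin_eq cs hM, hc, mul_div_cancel_right₀ _ (hτ.ne_zero cs)]

theorem parabolic_finite (hM : ∀ i j, Mat.M i j = coxF4 i j) (σ : Finset (Fin 4)) :
    (parabolic cs σ : Set W).Finite :=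
  ((hasGrowth_0123 cs hM).finite cs).subset
    (Subgroup.closure_mono (Set.image_mono fun i _ => by fin_cases i <;> simp))

/-- The coordinate of a chain at `e_σ`. -/
noncomputable def coord {k : ℕ} (σ : Finset (Fin 4)) : (KW cs k → R) →ₗ[R] R :=
  letI := Classical.dec (σ.card = k ∧ (parabolic cs σ : Set W).Finite)
  if h : σ.card = k ∧ (parabolic cs σ : Set W).Finite then LinearMap.proj ⟨σ, h⟩ else 0

theorem coord_coe {k : ℕ} (x : KW cs k → R) (σ : KW cs k) : coord cs σ.1 x = x σ := by
  rw [coord, dif_pos σ.2]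
  rfl

theorem coord_of_card_ne {k : ℕ} (x : KW cs k → R) {σ : Finset (Fin 4)} (h : σ.card ≠ k) :
    coord cs σ x = 0 := by
  rw [coord, dif_neg fun h' => h h'.1]
  rfl

theorem eq_of_coord_eq {k : ℕ} {x y : KW cs k → R}
    (h : ∀ σ, σ.card = k → coord cs σ x = coord cs σ y) : x = y := by
  funext σ
  rw [← coord_coe cs x, ← coord_coe cs y, h σ.1 σ.2.1]

/-- The chain with prescribed coordinates. -/
def chainOf (k : ℕ) (F : Finset (Fin 4) → R) : KW cs k → R := fun σ => F σ.1

theorem coord_chainOf (hM : ∀ i j, Mat.M i j = coxF4 i j) {k : ℕ} (F : Finset (Fin 4) → R)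
    {σ : Finset (Fin 4)} (hσ : σ.card = k) : coord cs σ (chainOf cs k F) = F σ :=
  coord_coe cs (chainOf cs k F) ⟨σ, hσ, parabolic_finite cs hM σ⟩

theorem coord_bdry (hM : ∀ i j, Mat.M i j = coxF4 i j) {k : ℕ} (y : KW cs (k + 1) → R)
    {τ : Finset (Fin 4)} (hτ : τ.card = k) :
    coord cs τ (bdry cs k y) = ∑ s ∈ τᶜ, (-1 : R) ^ (τ.filter (fun t => t < s)).card *
      Polynomial.toLaurent (poin cs (insert s τ) / poin cs τ) * coord cs (insert s τ) y := by
  have h1 : coord cs τ (bdry cs k y) = ∑ σ : Finset (Fin 4), bcoeff cs σ τ * coord cs σ y := by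
    have h2 := coord_coe cs (bdry cs k y) ⟨τ, hτ, parabolic_finite cs hM τ⟩
    rw [show coord cs τ (bdry cs k y) = bdry cs k y ⟨τ, hτ, parabolic_finite cs hM τ⟩ from h2]
    have h3 : bdry cs k y ⟨τ, hτ, parabolic_finite cs hM τ⟩ =
        ∑ σ : KW cs (k + 1), bcoeff cs σ.1 τ * coord cs σ.1 y := by
      simp only [coord_coe]
      rfl
    rw [h3]
    refine Finset.sum_of_injOn (fun σ => σ.1) Subtype.val_injective.injOn (by simp) ?_
      (fun _ _ => rfl)
    intro σ _ hσ
    rw [coord_of_card_ne cs y, mul_zero]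
    intro hc
    exact hσ ⟨⟨σ, hc, parabolic_finite cs hM σ⟩, by simp⟩
  rw [h1]
  simp only [bcoeff, Finset.sum_mul]
  rw [Finset.sum_sigma']
  symm
  refine Finset.sum_of_injOn (fun s => (⟨insert s τ, s⟩ : (_ : Finset (Fin 4)) × Fin 4))
    (fun s _ t _ h => (Sigma.mk.inj_iff.1 h).2.eq) (by intro s; simp) ?_ ?_
  · rintro ⟨σ, s⟩ hs hns
    simp only [Finset.mem_sigma, Finset.mem_univ, true_and] at hs
    rw [if_neg, zero_mul]
    rintro rfl
    exact hns ⟨s, by simp, by simp [Finset.insert_erase hs]⟩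
  · intro s hs
    have hs' : s ∉ τ := by simpa using hs
    rw [if_pos (Finset.erase_insert hs').symm, Finset.filter_insert, if_neg (lt_irrefl s)]

theorem mem_cycles_succ {k : ℕ} (x : KW cs (k + 1) → R) :
    x ∈ cycles cs (k + 1) ↔ bdry cs k x = 0 := Iff.rfl

/-- A criterion for the homology in degree `k` to be cyclic, generated by the class of `z`. -/
theorem nonempty_Hgy_equiv {k : ℕ} {f : R} (θ : (KW cs k → R) →ₗ[R] R) {z : KW cs k → R}
    (hz : z ∈ cycles cs k) (hθ : θ z = 1) {w : KW cs (k + 1) → R} (hw : bdry cs k w = f • z)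
    (hdvd : ∀ y, f ∣ θ (bdry cs k y))
    (hker : ∀ x ∈ cycles cs k, θ x = 0 → ∃ y, bdry cs k y = x) :
    Nonempty (Hgy cs k ≃ₗ[R] R ⧸ Ideal.span {f}) := by
  let φ : cycles cs k →ₗ[R] R ⧸ Ideal.span {f} :=
    (Ideal.span {f}).mkQ ∘ₗ θ ∘ₗ (cycles cs k).subtype
  have hφ : Function.Surjective φ := by
    intro r
    obtain ⟨r, rfl⟩ := Submodule.mkQ_surjective _ r
    refine ⟨r • ⟨z, hz⟩, ?_⟩
    simp [φ, hθ]
  have hk : Submodule.comap (cycles cs k).subtype (LinearMap.range (bdry cs k)) =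
      LinearMap.ker φ := by
    ext ⟨x, hx⟩
    simp only [Submodule.mem_comap, Submodule.subtype_apply, LinearMap.mem_range,
      LinearMap.mem_ker, φ, LinearMap.comp_apply, Submodule.mkQ_apply,
      Submodule.Quotient.mk_eq_zero, Ideal.mem_span_singleton]
    constructor
    · rintro ⟨y, rfl⟩
      exact hdvd y
    · rintro ⟨r, hr⟩
      have hmem : x - (f * r) • z ∈ cycles cs k := sub_mem hx (Submodule.smul_mem _ _ hz)
      obtain ⟨y, hy⟩ :=
        hker _ hmem (by rw [map_sub, map_smul, hθ, hr, smul_eq_mul, mul_one, sub_self])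
      refine ⟨y + r • w, ?_⟩
      rw [map_add, map_smul, hy, hw, smul_smul, mul_comm r f, sub_add_cancel]
  exact ⟨(Submodule.quotEquivOfEq _ _ hk).trans (φ.quotKerEquivOfSurjective hφ)⟩

end Coordinates

/-! ### The boundary maps in type `F₄` -/

section Boundary

variable {W : Type*} [Group W] {Mat : CoxeterMatrix (Fin 4)} (cs : CoxeterSystem Mat W)

/-- The Laurent polynomial `q`. -/
noncomputable def lq : R := Polynomial.toLaurent X

/-- The ratio of the Poincaré polynomials of types `F₄` and `B₃`, evaluated at `q`. -/
noncomputable def ratioF4 : R :=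
  1 + lq + lq ^ 2 + lq ^ 3 + 2 * lq ^ 4 + 2 * lq ^ 5 + 2 * lq ^ 6 + 2 * lq ^ 7 + 2 * lq ^ 8 + 2 *
    lq ^ 9 + 2 * lq ^ 10 + 2 * lq ^ 11 + lq ^ 12 + lq ^ 13 + lq ^ 14 + lq ^ 15

theorem toLaurent_X_eq_lq : Polynomial.toLaurent (X : ℚ[X]) = lq := rfl

theorem coord_bdry_term (hM : ∀ i j, Mat.M i j = coxF4 i j) {k : ℕ} (y : KW cs k → R)
    {σ τ : Finset (Fin 4)} {u v : List (Fin 4)} {P Q : ℚ[X]} (hσ : HasGrowth cs σ u P)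
    (hτ : HasGrowth cs τ v Q) (s : Fin 4) (hs : insert s τ = σ) (n : ℕ)
    (hn : (τ.filter (fun t => t < s)).card = n) (c : ℚ[X]) (hc : P = c * Q) :
    (-1 : R) ^ (τ.filter (fun t => t < s)).card *
      Polynomial.toLaurent (poin cs (insert s τ) / poin cs τ) * coord cs (insert s τ) y =
    (-1) ^ n * Polynomial.toLaurent c * coord cs σ y := by
  rw [hs, hn, hσ.poin_div cs hM hτ c hc]

theorem coord_bdry_empty (hM : ∀ i j, Mat.M i j = coxF4 i j) (y : KW cs 1 → R) :
    coord cs ∅ (bdry cs 0 y) = (1 + lq) * coord cs {0} y + (1 + lq) * coord cs {1} y + (1 + lq) *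
      coord cs {2} y + (1 + lq) * coord cs {3} y := by
  rw [coord_bdry cs hM y (by decide), show (∅ : Finset (Fin 4))ᶜ = {0, 1, 2, 3} by decide]
  rw [Finset.sum_insert (by decide), Finset.sum_insert (by decide), Finset.sum_insert (by
    decide), Finset.sum_singleton]
  rw [coord_bdry_term cs hM y (hasGrowth_0 cs hM) (hasGrowth_empty cs) 0 (by decide) 0 rfl
    (1 + X) (by ring)]
  rw [coord_bdry_term cs hM y (hasGrowth_1 cs hM) (hasGrowth_empty cs) 1 (by decide) 0 rfl
    (1 + X) (by ring)]
  rw [coord_bdry_term cs hM y (hasGrowth_2 cs hM) (hasGrowth_empty cs) 2 (by decide) 0 rfl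
    (1 + X) (by ring)]
  rw [coord_bdry_term cs hM y (hasGrowth_3 cs hM) (hasGrowth_empty cs) 3 (by decide) 0 rfl
    (1 + X) (by ring)]
  simp only [map_add, map_one, toLaurent_X_eq_lq]
  ring

theorem coord_bdry_0 (hM : ∀ i j, Mat.M i j = coxF4 i j) (y : KW cs 2 → R) :
    coord cs {0} (bdry cs 1 y) = -(1 + lq + lq ^ 2) * coord cs {0, 1} y - (1 + lq) * coord cs {0,
      2} y - (1 + lq) * coord cs {0, 3} y := by
  rw [coord_bdry cs hM y (by decide), show ({0} : Finset (Fin 4))ᶜ = {1, 2, 3} by decide]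
  rw [Finset.sum_insert (by decide), Finset.sum_insert (by decide), Finset.sum_singleton]
  rw [coord_bdry_term cs hM y (hasGrowth_01 cs hM) (hasGrowth_0 cs hM) 1 (by decide) 1 rfl
    (1 + X + X ^ 2) (by ring)]
  rw [coord_bdry_term cs hM y (hasGrowth_02 cs hM) (hasGrowth_0 cs hM) 2 (by decide) 1 rfl
    (1 + X) (by ring)]
  rw [coord_bdry_term cs hM y (hasGrowth_03 cs hM) (hasGrowth_0 cs hM) 3 (by decide) 1 rfl
    (1 + X) (by ring)]
  simp only [map_add, map_pow, map_one, toLaurent_X_eq_lq]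
  ring

theorem coord_bdry_1 (hM : ∀ i j, Mat.M i j = coxF4 i j) (y : KW cs 2 → R) :
    coord cs {1} (bdry cs 1 y) = (1 + lq + lq ^ 2) * coord cs {0, 1} y - (1 + lq + lq ^ 2 + lq ^
      3) * coord cs {1, 2} y - (1 + lq) * coord cs {1, 3} y := by
  rw [coord_bdry cs hM y (by decide), show ({1} : Finset (Fin 4))ᶜ = {0, 2, 3} by decide]
  rw [Finset.sum_insert (by decide), Finset.sum_insert (by decide), Finset.sum_singleton]
  rw [coord_bdry_term cs hM y (hasGrowth_01 cs hM) (hasGrowth_1 cs hM) 0 (by decide) 0 rfl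
    (1 + X + X ^ 2) (by ring)]
  rw [coord_bdry_term cs hM y (hasGrowth_12 cs hM) (hasGrowth_1 cs hM) 2 (by decide) 1 rfl
    (1 + X + X ^ 2 + X ^ 3) (by ring)]
  rw [coord_bdry_term cs hM y (hasGrowth_13 cs hM) (hasGrowth_1 cs hM) 3 (by decide) 1 rfl
    (1 + X) (by ring)]
  simp only [map_add, map_pow, map_one, toLaurent_X_eq_lq]
  ring

theorem coord_bdry_2 (hM : ∀ i j, Mat.M i j = coxF4 i j) (y : KW cs 2 → R) :
    coord cs {2} (bdry cs 1 y) = (1 + lq) * coord cs {0, 2} y + (1 + lq + lq ^ 2 + lq ^ 3) *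
      coord cs {1, 2} y - (1 + lq + lq ^ 2) * coord cs {2, 3} y := by
  rw [coord_bdry cs hM y (by decide), show ({2} : Finset (Fin 4))ᶜ = {0, 1, 3} by decide]
  rw [Finset.sum_insert (by decide), Finset.sum_insert (by decide), Finset.sum_singleton]
  rw [coord_bdry_term cs hM y (hasGrowth_02 cs hM) (hasGrowth_2 cs hM) 0 (by decide) 0 rfl
    (1 + X) (by ring)]
  rw [coord_bdry_term cs hM y (hasGrowth_12 cs hM) (hasGrowth_2 cs hM) 1 (by decide) 0 rfl
    (1 + X + X ^ 2 + X ^ 3) (by ring)]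
  rw [coord_bdry_term cs hM y (hasGrowth_23 cs hM) (hasGrowth_2 cs hM) 3 (by decide) 1 rfl
    (1 + X + X ^ 2) (by ring)]
  simp only [map_add, map_pow, map_one, toLaurent_X_eq_lq]
  ring

theorem coord_bdry_3 (hM : ∀ i j, Mat.M i j = coxF4 i j) (y : KW cs 2 → R) :
    coord cs {3} (bdry cs 1 y) = (1 + lq) * coord cs {0, 3} y + (1 + lq) * coord cs {1, 3} y + (1
      + lq + lq ^ 2) * coord cs {2, 3} y := by
  rw [coord_bdry cs hM y (by decide), show ({3} : Finset (Fin 4))ᶜ = {0, 1, 2} by decide]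
  rw [Finset.sum_insert (by decide), Finset.sum_insert (by decide), Finset.sum_singleton]
  rw [coord_bdry_term cs hM y (hasGrowth_03 cs hM) (hasGrowth_3 cs hM) 0 (by decide) 0 rfl
    (1 + X) (by ring)]
  rw [coord_bdry_term cs hM y (hasGrowth_13 cs hM) (hasGrowth_3 cs hM) 1 (by decide) 0 rfl
    (1 + X) (by ring)]
  rw [coord_bdry_term cs hM y (hasGrowth_23 cs hM) (hasGrowth_3 cs hM) 2 (by decide) 0 rfl
    (1 + X + X ^ 2) (by ring)]
  simp only [map_add, map_pow, map_one, toLaurent_X_eq_lq]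
  ring

theorem coord_bdry_01 (hM : ∀ i j, Mat.M i j = coxF4 i j) (y : KW cs 3 → R) :
    coord cs {0, 1} (bdry cs 2 y) = ((1 + lq + lq ^ 2 + lq ^ 3) * (1 + lq ^ 3)) * coord cs {0, 1,
      2} y + (1 + lq) * coord cs {0, 1, 3} y := by
  rw [coord_bdry cs hM y (by decide), show ({0, 1} : Finset (Fin 4))ᶜ = {2, 3} by decide]
  rw [Finset.sum_insert (by decide), Finset.sum_singleton]
  rw [coord_bdry_term cs hM y (hasGrowth_012 cs hM) (hasGrowth_01 cs hM) 2 (by decide) 2 rfl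
    ((1 + X + X ^ 2 + X ^ 3) * (1 + X ^ 3)) (by ring)]
  rw [coord_bdry_term cs hM y (hasGrowth_013 cs hM) (hasGrowth_01 cs hM) 3 (by decide) 2 rfl
    (1 + X) (by ring)]
  simp only [map_add, map_mul, map_pow, map_one, toLaurent_X_eq_lq]
  ring

theorem coord_bdry_02 (hM : ∀ i j, Mat.M i j = coxF4 i j) (y : KW cs 3 → R) :
    coord cs {0, 2} (bdry cs 2 y) = -((1 + lq ^ 2) * (1 + lq + lq ^ 2 + lq ^ 3 + lq ^ 4 + lq ^
      5)) * coord cs {0, 1, 2} y + (1 + lq + lq ^ 2) * coord cs {0, 2, 3} y := by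
  rw [coord_bdry cs hM y (by decide), show ({0, 2} : Finset (Fin 4))ᶜ = {1, 3} by decide]
  rw [Finset.sum_insert (by decide), Finset.sum_singleton]
  rw [coord_bdry_term cs hM y (hasGrowth_012 cs hM) (hasGrowth_02 cs hM) 1 (by decide) 1 rfl
    ((1 + X ^ 2) * (1 + X + X ^ 2 + X ^ 3 + X ^ 4 + X ^ 5)) (by ring)]
  rw [coord_bdry_term cs hM y (hasGrowth_023 cs hM) (hasGrowth_02 cs hM) 3 (by decide) 2 rfl
    (1 + X + X ^ 2) (by ring)]
  simp only [map_add, map_mul, map_pow, map_one, toLaurent_X_eq_lq]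
  ring

theorem coord_bdry_03 (hM : ∀ i j, Mat.M i j = coxF4 i j) (y : KW cs 3 → R) :
    coord cs {0, 3} (bdry cs 2 y) = -(1 + lq + lq ^ 2) * coord cs {0, 1, 3} y - (1 + lq + lq ^ 2)
      * coord cs {0, 2, 3} y := by
  rw [coord_bdry cs hM y (by decide), show ({0, 3} : Finset (Fin 4))ᶜ = {1, 2} by decide]
  rw [Finset.sum_insert (by decide), Finset.sum_singleton]
  rw [coord_bdry_term cs hM y (hasGrowth_013 cs hM) (hasGrowth_03 cs hM) 1 (by decide) 1 rfl
    (1 + X + X ^ 2) (by ring)]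
  rw [coord_bdry_term cs hM y (hasGrowth_023 cs hM) (hasGrowth_03 cs hM) 2 (by decide) 1 rfl
    (1 + X + X ^ 2) (by ring)]
  simp only [map_add, map_pow, map_one, toLaurent_X_eq_lq]
  ring

theorem coord_bdry_12 (hM : ∀ i j, Mat.M i j = coxF4 i j) (y : KW cs 3 → R) :
    coord cs {1, 2} (bdry cs 2 y) = (1 + lq + lq ^ 2 + lq ^ 3 + lq ^ 4 + lq ^ 5) * coord cs {0,
      1, 2} y + (1 + lq + lq ^ 2 + lq ^ 3 + lq ^ 4 + lq ^ 5) * coord cs {1, 2, 3} y := by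
  rw [coord_bdry cs hM y (by decide), show ({1, 2} : Finset (Fin 4))ᶜ = {0, 3} by decide]
  rw [Finset.sum_insert (by decide), Finset.sum_singleton]
  rw [coord_bdry_term cs hM y (hasGrowth_012 cs hM) (hasGrowth_12 cs hM) 0 (by decide) 0 rfl
    (1 + X + X ^ 2 + X ^ 3 + X ^ 4 + X ^ 5) (by ring)]
  rw [coord_bdry_term cs hM y (hasGrowth_123 cs hM) (hasGrowth_12 cs hM) 3 (by decide) 2 rfl
    (1 + X + X ^ 2 + X ^ 3 + X ^ 4 + X ^ 5) (by ring)]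
  simp only [map_add, map_pow, map_one, toLaurent_X_eq_lq]
  ring

theorem coord_bdry_13 (hM : ∀ i j, Mat.M i j = coxF4 i j) (y : KW cs 3 → R) :
    coord cs {1, 3} (bdry cs 2 y) = (1 + lq + lq ^ 2) * coord cs {0, 1, 3} y - ((1 + lq ^ 2) * (1
      + lq + lq ^ 2 + lq ^ 3 + lq ^ 4 + lq ^ 5)) * coord cs {1, 2, 3} y := by
  rw [coord_bdry cs hM y (by decide), show ({1, 3} : Finset (Fin 4))ᶜ = {0, 2} by decide]
  rw [Finset.sum_insert (by decide), Finset.sum_singleton]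
  rw [coord_bdry_term cs hM y (hasGrowth_013 cs hM) (hasGrowth_13 cs hM) 0 (by decide) 0 rfl
    (1 + X + X ^ 2) (by ring)]
  rw [coord_bdry_term cs hM y (hasGrowth_123 cs hM) (hasGrowth_13 cs hM) 2 (by decide) 1 rfl
    ((1 + X ^ 2) * (1 + X + X ^ 2 + X ^ 3 + X ^ 4 + X ^ 5)) (by ring)]
  simp only [map_add, map_mul, map_pow, map_one, toLaurent_X_eq_lq]
  ring

theorem coord_bdry_23 (hM : ∀ i j, Mat.M i j = coxF4 i j) (y : KW cs 3 → R) :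
    coord cs {2, 3} (bdry cs 2 y) = (1 + lq) * coord cs {0, 2, 3} y + ((1 + lq + lq ^ 2 + lq ^ 3)
      * (1 + lq ^ 3)) * coord cs {1, 2, 3} y := by
  rw [coord_bdry cs hM y (by decide), show ({2, 3} : Finset (Fin 4))ᶜ = {0, 1} by decide]
  rw [Finset.sum_insert (by decide), Finset.sum_singleton]
  rw [coord_bdry_term cs hM y (hasGrowth_023 cs hM) (hasGrowth_23 cs hM) 0 (by decide) 0 rfl
    (1 + X) (by ring)]
  rw [coord_bdry_term cs hM y (hasGrowth_123 cs hM) (hasGrowth_23 cs hM) 1 (by decide) 0 rfl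
    ((1 + X + X ^ 2 + X ^ 3) * (1 + X ^ 3)) (by ring)]
  simp only [map_add, map_mul, map_pow, map_one, toLaurent_X_eq_lq]
  ring

theorem coord_bdry_012 (hM : ∀ i j, Mat.M i j = coxF4 i j) (y : KW cs 4 → R) :
    coord cs {0, 1, 2} (bdry cs 3 y) = -ratioF4 * coord cs {0, 1, 2, 3} y := by
  rw [coord_bdry cs hM y (by decide), show ({0, 1, 2} : Finset (Fin 4))ᶜ = {3} by decide]
  rw [Finset.sum_singleton]
  rw [coord_bdry_term cs hM y (hasGrowth_0123 cs hM) (hasGrowth_012 cs hM) 3 (by decide) 3 rfl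
    (1 + X + X ^ 2 + X ^ 3 + 2 * X ^ 4 + 2 * X ^ 5 + 2 * X ^ 6 + 2 * X ^ 7 + 2 * X ^ 8 + 2 * X ^
      9 + 2 * X ^ 10 + 2 * X ^ 11 + X ^ 12 + X ^ 13 + X ^ 14 + X ^ 15) (by ring)]
  simp only [map_add, map_mul, map_pow, map_one, map_ofNat, toLaurent_X_eq_lq, ratioF4]
  ring

theorem coord_bdry_013 (hM : ∀ i j, Mat.M i j = coxF4 i j) (y : KW cs 4 → R) :
    coord cs {0, 1, 3} (bdry cs 3 y) = ((1 + lq ^ 2 + lq ^ 3 + lq ^ 5) * (ratioF4)) * coord cs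
      {0, 1, 2, 3} y := by
  rw [coord_bdry cs hM y (by decide), show ({0, 1, 3} : Finset (Fin 4))ᶜ = {2} by decide]
  rw [Finset.sum_singleton]
  rw [coord_bdry_term cs hM y (hasGrowth_0123 cs hM) (hasGrowth_013 cs hM) 2 (by decide) 2 rfl
    ((1 + X ^ 2 + X ^ 3 + X ^ 5) * (1 + X + X ^ 2 + X ^ 3 + 2 * X ^ 4 + 2 * X ^ 5 + 2 * X ^ 6 + 2
      * X ^ 7 + 2 * X ^ 8 + 2 * X ^ 9 + 2 * X ^ 10 + 2 * X ^ 11 + X ^ 12 + X ^ 13 + X ^ 14 + X ^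
      15)) (by ring)]
  simp only [map_add, map_mul, map_pow, map_one, map_ofNat, toLaurent_X_eq_lq, ratioF4]
  ring

theorem coord_bdry_023 (hM : ∀ i j, Mat.M i j = coxF4 i j) (y : KW cs 4 → R) :
    coord cs {0, 2, 3} (bdry cs 3 y) = -((1 + lq ^ 2 + lq ^ 3 + lq ^ 5) * (ratioF4)) * coord cs
      {0, 1, 2, 3} y := by
  rw [coord_bdry cs hM y (by decide), show ({0, 2, 3} : Finset (Fin 4))ᶜ = {1} by decide]
  rw [Finset.sum_singleton]
  rw [coord_bdry_term cs hM y (hasGrowth_0123 cs hM) (hasGrowth_023 cs hM) 1 (by decide) 1 rfl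
    ((1 + X ^ 2 + X ^ 3 + X ^ 5) * (1 + X + X ^ 2 + X ^ 3 + 2 * X ^ 4 + 2 * X ^ 5 + 2 * X ^ 6 + 2
      * X ^ 7 + 2 * X ^ 8 + 2 * X ^ 9 + 2 * X ^ 10 + 2 * X ^ 11 + X ^ 12 + X ^ 13 + X ^ 14 + X ^
      15)) (by ring)]
  simp only [map_add, map_mul, map_pow, map_one, map_ofNat, toLaurent_X_eq_lq, ratioF4]
  ring

theorem coord_bdry_123 (hM : ∀ i j, Mat.M i j = coxF4 i j) (y : KW cs 4 → R) :
    coord cs {1, 2, 3} (bdry cs 3 y) = ratioF4 * coord cs {0, 1, 2, 3} y := by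
  rw [coord_bdry cs hM y (by decide), show ({1, 2, 3} : Finset (Fin 4))ᶜ = {0} by decide]
  rw [Finset.sum_singleton]
  rw [coord_bdry_term cs hM y (hasGrowth_0123 cs hM) (hasGrowth_123 cs hM) 0 (by decide) 0 rfl
    (1 + X + X ^ 2 + X ^ 3 + 2 * X ^ 4 + 2 * X ^ 5 + 2 * X ^ 6 + 2 * X ^ 7 + 2 * X ^ 8 + 2 * X ^
      9 + 2 * X ^ 10 + 2 * X ^ 11 + X ^ 12 + X ^ 13 + X ^ 14 + X ^ 15) (by ring)]
  simp only [map_add, map_mul, map_pow, map_one, map_ofNat, toLaurent_X_eq_lq, ratioF4]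
  ring

end Boundary

/-! ### Homology in type `F₄` -/

section Homology

variable {W : Type*} [Group W] {Mat : CoxeterMatrix (Fin 4)} (cs : CoxeterSystem Mat W)

theorem toLaurent_ne_zero_of_eval_one {p : ℚ[X]} (h : p.eval 1 ≠ 0) :
    Polynomial.toLaurent p ≠ 0 := by
  rw [Polynomial.toLaurent_ne_zero]
  rintro rfl
  simp at h

theorem one_add_lq_ne_zero : (1 + lq : R) ≠ 0 := by
  have := toLaurent_ne_zero_of_eval_one (p := 1 + X) (by norm_num)
  simpa only [map_add, map_one, toLaurent_X_eq_lq] using this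

theorem ratioF4_ne_zero : ratioF4 ≠ 0 := by
  have := toLaurent_ne_zero_of_eval_one (p := 1 + X + X ^ 2 + X ^ 3 + 2 * X ^ 4 + 2 * X ^ 5 +
    2 * X ^ 6 + 2 * X ^ 7 + 2 * X ^ 8 + 2 * X ^ 9 + 2 * X ^ 10 + 2 * X ^ 11 + X ^ 12 + X ^ 13 +
    X ^ 14 + X ^ 15) (by norm_num)
  simpa only [map_add, map_mul, map_pow, map_one, map_ofNat, toLaurent_X_eq_lq, ratioF4] using this

theorem chain_zero_ext {x y : KW cs 0 → R} (h : coord cs ∅ x = coord cs ∅ y) : x = y := by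
  refine eq_of_coord_eq cs fun σ hσ => ?_
  rw [Finset.card_eq_zero.1 hσ, h]

theorem chain_one_ext {x y : KW cs 1 → R} (h0 : coord cs {0} x = coord cs {0} y)
    (h1 : coord cs {1} x = coord cs {1} y) (h2 : coord cs {2} x = coord cs {2} y)
    (h3 : coord cs {3} x = coord cs {3} y) : x = y := by
  refine eq_of_coord_eq cs fun σ hσ => ?_
  have : ∀ σ : Finset (Fin 4), σ.card = 1 → σ = {0} ∨ σ = {1} ∨ σ = {2} ∨ σ = {3} := by decide
  rcases this σ hσ with rfl | rfl | rfl | rfl <;> assumption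

theorem chain_two_ext {x y : KW cs 2 → R} (h01 : coord cs {0, 1} x = coord cs {0, 1} y)
    (h02 : coord cs {0, 2} x = coord cs {0, 2} y) (h03 : coord cs {0, 3} x = coord cs {0, 3} y)
    (h12 : coord cs {1, 2} x = coord cs {1, 2} y) (h13 : coord cs {1, 3} x = coord cs {1, 3} y)
    (h23 : coord cs {2, 3} x = coord cs {2, 3} y) : x = y := by
  refine eq_of_coord_eq cs fun σ hσ => ?_
  have : ∀ σ : Finset (Fin 4), σ.card = 2 →
      σ = {0, 1} ∨ σ = {0, 2} ∨ σ = {0, 3} ∨ σ = {1, 2} ∨ σ = {1, 3} ∨ σ = {2, 3} := by decide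
  rcases this σ hσ with rfl | rfl | rfl | rfl | rfl | rfl <;> assumption

theorem chain_three_ext {x y : KW cs 3 → R}
    (h012 : coord cs {0, 1, 2} x = coord cs {0, 1, 2} y)
    (h013 : coord cs {0, 1, 3} x = coord cs {0, 1, 3} y)
    (h023 : coord cs {0, 2, 3} x = coord cs {0, 2, 3} y)
    (h123 : coord cs {1, 2, 3} x = coord cs {1, 2, 3} y) : x = y := by
  refine eq_of_coord_eq cs fun σ hσ => ?_
  have : ∀ σ : Finset (Fin 4), σ.card = 3 →
      σ = {0, 1, 2} ∨ σ = {0, 1, 3} ∨ σ = {0, 2, 3} ∨ σ = {1, 2, 3} := by decide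
  rcases this σ hσ with rfl | rfl | rfl | rfl <;> assumption

theorem exists_chain_one (hM : ∀ i j, Mat.M i j = coxF4 i j) (a b c d : R) :
    ∃ y : KW cs 1 → R, coord cs {0} y = a ∧ coord cs {1} y = b ∧ coord cs {2} y = c ∧
      coord cs {3} y = d := by
  refine ⟨chainOf cs 1 fun σ => if σ = {0} then a else if σ = {1} then b else
    if σ = {2} then c else d, ?_, ?_, ?_, ?_⟩ <;>
  rw [coord_chainOf cs hM _ (by decide)] <;> rfl

theorem exists_chain_two (hM : ∀ i j, Mat.M i j = coxF4 i j) (a b c d e f : R) :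
    ∃ y : KW cs 2 → R, coord cs {0, 1} y = a ∧ coord cs {0, 2} y = b ∧ coord cs {0, 3} y = c ∧
      coord cs {1, 2} y = d ∧ coord cs {1, 3} y = e ∧ coord cs {2, 3} y = f := by
  refine ⟨chainOf cs 2 fun σ => if σ = {0, 1} then a else if σ = {0, 2} then b else
    if σ = {0, 3} then c else if σ = {1, 2} then d else if σ = {1, 3} then e else f,
    ?_, ?_, ?_, ?_, ?_, ?_⟩ <;>
  rw [coord_chainOf cs hM _ (by decide)] <;> rfl

theorem exists_chain_three (hM : ∀ i j, Mat.M i j = coxF4 i j) (a b c d : R) :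
    ∃ y : KW cs 3 → R, coord cs {0, 1, 2} y = a ∧ coord cs {0, 1, 3} y = b ∧
      coord cs {0, 2, 3} y = c ∧ coord cs {1, 2, 3} y = d := by
  refine ⟨chainOf cs 3 fun σ => if σ = {0, 1, 2} then a else if σ = {0, 1, 3} then b else
    if σ = {0, 2, 3} then c else d, ?_, ?_, ?_, ?_⟩ <;>
  rw [coord_chainOf cs hM _ (by decide)] <;> rfl

theorem nonempty_Hgy_zero (hM : ∀ i j, Mat.M i j = coxF4 i j) :
    Nonempty (Hgy cs 0 ≃ₗ[R] R ⧸ Ideal.span {(1 + lq : R)}) := by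
  have hz : coord cs ∅ (chainOf cs 0 fun _ => 1) = 1 := coord_chainOf cs hM _ rfl
  obtain ⟨w, hw0, hw1, hw2, hw3⟩ := exists_chain_one cs hM 1 0 0 0
  refine nonempty_Hgy_equiv cs (coord cs ∅) (z := chainOf cs 0 fun _ => 1) Submodule.mem_top hz
    (w := w) ?_ (fun y => ?_) fun x _ hx => ⟨0, ?_⟩
  · apply chain_zero_ext
    rw [coord_bdry_empty cs hM, map_smul, hz, hw0, hw1, hw2, hw3, smul_eq_mul]
    ring
  · refine ⟨coord cs {0} y + coord cs {1} y + coord cs {2} y + coord cs {3} y, ?_⟩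
    rw [coord_bdry_empty cs hM]
    ring
  · apply chain_zero_ext
    rw [map_zero, map_zero, hx]

theorem mem_cycles_one (hM : ∀ i j, Mat.M i j = coxF4 i j) {x : KW cs 1 → R} :
    x ∈ cycles cs 1 ↔
      coord cs {0} x + coord cs {1} x + coord cs {2} x + coord cs {3} x = 0 := by
  have h : coord cs ∅ (bdry cs 0 x) = (1 + lq) *
      (coord cs {0} x + coord cs {1} x + coord cs {2} x + coord cs {3} x) := by
    rw [coord_bdry_empty cs hM]
    ring
  rw [mem_cycles_succ]
  constructor
  · intro hx
    rw [hx, map_zero] at h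
    exact (mul_eq_zero.1 h.symm).resolve_left one_add_lq_ne_zero
  · intro hx
    apply chain_zero_ext
    rw [h, hx, mul_zero, map_zero]

theorem nonempty_Hgy_one (hM : ∀ i j, Mat.M i j = coxF4 i j) :
    Nonempty (Hgy cs 1 ≃ₗ[R] R ⧸ Ideal.span {(1 + lq : R)}) := by
  obtain ⟨z, hz0, hz1, hz2, hz3⟩ := exists_chain_one cs hM (-1) 0 0 1
  obtain ⟨w, hw01, hw02, hw03, hw12, hw13, hw23⟩ := exists_chain_two cs hM 0 0 1 0 0 0
  let θ : (KW cs 1 → R) →ₗ[R] R :=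
    -(lq + lq ^ 2) • coord cs {1} + (1 + lq + lq ^ 2) • coord cs {2} + coord cs {3}
  have hθ : ∀ x, θ x = -(lq + lq ^ 2) * coord cs {1} x + (1 + lq + lq ^ 2) * coord cs {2} x +
      coord cs {3} x := fun x => rfl
  refine nonempty_Hgy_equiv cs θ (z := z) ?_ ?_ (w := w) ?_ (fun y => ?_) fun x hx hx' => ?_
  · rw [mem_cycles_one cs hM, hz0, hz1, hz2, hz3]
    ring
  · rw [hθ, hz1, hz2, hz3]
    ring
  · apply chain_one_ext <;>
    simp only [coord_bdry_0 cs hM, coord_bdry_1 cs hM, coord_bdry_2 cs hM, coord_bdry_3 cs hM,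
      map_smul, smul_eq_mul, hw01, hw02, hw03, hw12, hw13, hw23, hz0, hz1, hz2, hz3] <;>
    ring
  · refine ⟨-lq * (1 + lq + lq ^ 2) * coord cs {0, 1} y +
      (1 + lq ^ 2) * (1 + 2 * lq + 2 * lq ^ 2) * coord cs {1, 2} y +
      (1 + lq + lq ^ 2) * coord cs {1, 3} y + (1 + lq + lq ^ 2) * coord cs {0, 2} y -
      lq * (1 + lq + lq ^ 2) * coord cs {2, 3} y + coord cs {0, 3} y, ?_⟩
    rw [hθ, coord_bdry_1 cs hM, coord_bdry_2 cs hM, coord_bdry_3 cs hM]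
    ring
  · rw [mem_cycles_one cs hM] at hx
    rw [hθ] at hx'
    obtain ⟨y, h01, h02, h03, h12, h13, h23⟩ := exists_chain_two cs hM (coord cs {1} x)
      (-lq * coord cs {2} x) 0 0 (lq * coord cs {1} x) (-coord cs {2} x)
    refine ⟨y, chain_one_ext cs ?_ ?_ ?_ ?_⟩
    · rw [coord_bdry_0 cs hM, h01, h02, h03]
      linear_combination hx' - hx
    · rw [coord_bdry_1 cs hM, h01, h12, h13]
      ring
    · rw [coord_bdry_2 cs hM, h02, h12, h23]
      ring
    · rw [coord_bdry_3 cs hM, h03, h13, h23]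
      linear_combination -hx'

theorem nonempty_Hgy_two (hM : ∀ i j, Mat.M i j = coxF4 i j) :
    Nonempty (Hgy cs 2 ≃ₗ[R]
      R ⧸ Ideal.span {(1 + lq + lq ^ 2 + lq ^ 3 + lq ^ 4 + lq ^ 5 : R)}) := by
  obtain ⟨z, hz01, hz02, hz03, hz12, hz13, hz23⟩ := exists_chain_two cs hM 0 (-(1 + lq ^ 2))
    (1 + lq ^ 2) 1 (-(1 + lq ^ 2)) 0
  obtain ⟨w, hw012, hw013, hw023, hw123⟩ := exists_chain_three cs hM 1
    (-(1 + lq ^ 2 + lq ^ 3 + lq ^ 5)) 0 0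
  refine nonempty_Hgy_equiv cs (coord cs {1, 2}) (z := z) ?_ hz12 (w := w) ?_ (fun y => ?_)
    fun x hx hx' => ?_
  · rw [mem_cycles_succ]
    apply chain_one_ext <;>
    simp only [coord_bdry_0 cs hM, coord_bdry_1 cs hM, coord_bdry_2 cs hM, coord_bdry_3 cs hM,
      map_zero, hz01, hz02, hz03, hz12, hz13, hz23] <;>
    ring
  · apply chain_two_ext <;>
    simp only [coord_bdry_01 cs hM, coord_bdry_02 cs hM, coord_bdry_03 cs hM,
      coord_bdry_12 cs hM, coord_bdry_13 cs hM, coord_bdry_23 cs hM, map_smul, smul_eq_mul,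
      hw012, hw013, hw023, hw123, hz01, hz02, hz03, hz12, hz13, hz23] <;>
    ring
  · refine ⟨coord cs {0, 1, 2} y + coord cs {1, 2, 3} y, ?_⟩
    rw [coord_bdry_12 cs hM]
    ring
  · rw [mem_cycles_succ] at hx
    have e0 := coord_bdry_0 cs hM x
    have e1 := coord_bdry_1 cs hM x
    have e2 := coord_bdry_2 cs hM x
    have e3 := coord_bdry_3 cs hM x
    rw [hx, map_zero] at e0 e1 e2 e3
    obtain ⟨y, h012, h013, h023, h123⟩ := exists_chain_three cs hM 0
      (-(lq * coord cs {0, 1} x + coord cs {0, 2} x + coord cs {0, 3} x))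
      (-(coord cs {0, 3} x + coord cs {1, 3} x + lq * coord cs {2, 3} x)) 0
    refine ⟨y, chain_two_ext cs ?_ ?_ ?_ ?_ ?_ ?_⟩
    · rw [coord_bdry_01 cs hM, h012, h013]
      linear_combination -e0
    · apply mul_left_cancel₀ one_add_lq_ne_zero
      rw [coord_bdry_02 cs hM, h012, h023]
      linear_combination (1 + lq + lq ^ 2) * e3 + e2 + (1 + lq + lq ^ 2 + lq ^ 3) * hx'
    · apply mul_left_cancel₀ one_add_lq_ne_zero
      rw [coord_bdry_03 cs hM, h013, h023]
      linear_combination (1 + lq + lq ^ 2) * (e0 - e3) - e0 - e2 -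
        (1 + lq + lq ^ 2 + lq ^ 3) * hx'
    · rw [coord_bdry_12 cs hM, h012, h123, hx']
      ring
    · apply mul_left_cancel₀ one_add_lq_ne_zero
      rw [coord_bdry_13 cs hM, h013, h123]
      linear_combination -(1 + lq + lq ^ 2) * e0 - e1 + (1 + lq + lq ^ 2 + lq ^ 3) * hx'
    · rw [coord_bdry_23 cs hM, h023, h123]
      linear_combination e3

theorem nonempty_Hgy_three (hM : ∀ i j, Mat.M i j = coxF4 i j) :
    Nonempty (Hgy cs 3 ≃ₗ[R] R ⧸ Ideal.span {ratioF4}) := by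
  obtain ⟨z, hz012, hz013, hz023, hz123⟩ := exists_chain_three cs hM (-1)
    (1 + lq ^ 2 + lq ^ 3 + lq ^ 5) (-(1 + lq ^ 2 + lq ^ 3 + lq ^ 5)) 1
  have hw : coord cs {0, 1, 2, 3} (chainOf cs 4 fun _ => 1) = 1 := coord_chainOf cs hM _ rfl
  refine nonempty_Hgy_equiv cs (coord cs {1, 2, 3}) (z := z) ?_ hz123
    (w := chainOf cs 4 fun _ => 1) ?_ (fun y => ?_) fun x hx hx' => ⟨0, ?_⟩
  · rw [mem_cycles_succ]
    apply chain_two_ext <;>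
    simp only [coord_bdry_01 cs hM, coord_bdry_02 cs hM, coord_bdry_03 cs hM,
      coord_bdry_12 cs hM, coord_bdry_13 cs hM, coord_bdry_23 cs hM, map_zero,
      hz012, hz013, hz023, hz123] <;>
    ring
  · apply chain_three_ext <;>
    simp only [coord_bdry_012 cs hM, coord_bdry_013 cs hM, coord_bdry_023 cs hM,
      coord_bdry_123 cs hM, map_smul, smul_eq_mul, hw, hz012, hz013, hz023, hz123] <;>
    ring
  · refine ⟨coord cs {0, 1, 2, 3} y, ?_⟩
    rw [coord_bdry_123 cs hM]
  · rw [mem_cycles_succ] at hx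
    have e01 := coord_bdry_01 cs hM x
    have e12 := coord_bdry_12 cs hM x
    have e23 := coord_bdry_23 cs hM x
    rw [hx, map_zero, hx'] at e12 e23
    rw [hx, map_zero] at e01
    have n6 : (1 + lq + lq ^ 2 + lq ^ 3 + lq ^ 4 + lq ^ 5 : R) ≠ 0 := by
      have := toLaurent_ne_zero_of_eval_one (p := 1 + X + X ^ 2 + X ^ 3 + X ^ 4 + X ^ 5)
        (by norm_num)
      simpa only [map_add, map_pow, map_one, toLaurent_X_eq_lq] using this
    have h012 : coord cs {0, 1, 2} x = 0 := by
      apply mul_left_cancel₀ n6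
      linear_combination -e12
    have h023 : coord cs {0, 2, 3} x = 0 := by
      apply mul_left_cancel₀ one_add_lq_ne_zero
      linear_combination -e23
    have h013 : coord cs {0, 1, 3} x = 0 := by
      apply mul_left_cancel₀ one_add_lq_ne_zero
      rw [h012] at e01
      linear_combination -e01
    apply chain_three_ext <;> simp only [map_zero, h012, h013, h023, hx']

theorem subsingleton_Hgy (hM : ∀ i j, Mat.M i j = coxF4 i j) {k : ℕ} (hk : 4 ≤ k) :
    Subsingleton (Hgy cs k) := by
  have : Subsingleton (cycles cs k) := by
    refine ⟨fun a b => ?_⟩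
    have key : ∀ x ∈ cycles cs k, x = 0 := by
      intro x hx
      refine eq_of_coord_eq cs fun σ hσ => ?_
      have hc : σ.card ≤ 4 := σ.card_le_univ
      obtain rfl : k = 4 := by lia
      obtain rfl : σ = {0, 1, 2, 3} := by
        rw [(Finset.card_eq_iff_eq_univ σ).1 hσ]
        decide
      have e := coord_bdry_123 cs hM x
      rw [(mem_cycles_succ cs x).1 hx, map_zero] at e
      rw [map_zero]
      exact (mul_eq_zero.1 e.symm).resolve_left ratioF4_ne_zero
    exact Subtype.ext ((key _ a.2).trans (key _ b.2).symm)
  exact (Submodule.mkQ_surjective _).subsingleton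

/-- The Chinese remainder theorem for two coprime elements, as a linear equivalence. -/
theorem nonempty_quotient_mul_equiv {a b : R} (h : IsCoprime a b) {N : Type*} [AddCommGroup N]
    [Module R N] (e : Nonempty ((R ⧸ Ideal.span {b}) ≃ₗ[R] N)) :
    Nonempty ((R ⧸ Ideal.span {a * b}) ≃ₗ[R] (R ⧸ Ideal.span {a}) × N) := by
  obtain ⟨e⟩ := e
  let φ : R →ₗ[R] (R ⧸ Ideal.span {a}) × (R ⧸ Ideal.span {b}) :=
    (Ideal.span {a}).mkQ.prod (Ideal.span {b}).mkQ
  have hker : Ideal.span {a * b} = LinearMap.ker φ := by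
    ext x
    simp only [φ, LinearMap.ker_prod, Submodule.ker_mkQ, Submodule.mem_inf,
      Ideal.mem_span_singleton]
    exact ⟨fun hx => ⟨dvd_of_mul_right_dvd hx, dvd_of_mul_left_dvd hx⟩,
      fun hx => h.mul_dvd hx.1 hx.2⟩
  have hφ : Function.Surjective φ := by
    rintro ⟨r, s⟩
    obtain ⟨r, rfl⟩ := Submodule.mkQ_surjective _ r
    obtain ⟨s, rfl⟩ := Submodule.mkQ_surjective _ s
    obtain ⟨u, v, huv⟩ := h
    refine ⟨v * b * r + u * a * s, ?_⟩
    simp only [φ, LinearMap.prod_apply, Function.prod_apply, Submodule.mkQ_apply, Prod.mk.injEq,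
      Submodule.Quotient.eq, Ideal.mem_span_singleton]
    exact ⟨⟨u * (s - r), by linear_combination r * huv⟩,
      ⟨v * (r - s), by linear_combination s * huv⟩⟩
  exact ⟨((Submodule.quotEquivOfEq _ _ hker).trans (φ.quotKerEquivOfSurjective hφ)).trans
    ((LinearEquiv.refl R _).prodCongr e)⟩

theorem isCoprime_cyc {m n : ℕ} (h : m ≠ n) : IsCoprime (cyc m) (cyc n) :=
  (Polynomial.cyclotomic.isCoprime_rat h).map Polynomial.toLaurent

theorem cyc_two : cyc 2 = 1 + lq := by
  rw [cyc, cyclotomic_two, map_add, map_one, toLaurent_X_eq_lq, add_comm]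

theorem cyc_three : cyc 3 = 1 + lq + lq ^ 2 := by
  rw [cyc, cyclotomic_three, map_add, map_add, map_pow, map_one, toLaurent_X_eq_lq]
  ring

theorem cyclotomic_four_rat : cyclotomic 4 ℚ = X ^ 2 + 1 := by
  have h := cyclotomic_expand_eq_cyclotomic Nat.prime_two (dvd_refl 2) ℚ
  norm_num at h
  exact h.symm

theorem cyclotomic_eight_rat : cyclotomic 8 ℚ = X ^ 4 + 1 := by
  have h := cyclotomic_expand_eq_cyclotomic Nat.prime_two (show 2 ∣ 4 by norm_num) ℚ
  norm_num [cyclotomic_four_rat, ← pow_mul] at h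
  exact h.symm

theorem cyclotomic_twelve_rat : cyclotomic 12 ℚ = X ^ 4 - X ^ 2 + 1 := by
  have h := cyclotomic_expand_eq_cyclotomic Nat.prime_two (show 2 ∣ 6 by norm_num) ℚ
  norm_num [cyclotomic_six, ← pow_mul] at h
  exact h.symm

theorem cyc_four : cyc 4 = 1 + lq ^ 2 := by
  simp only [cyc, cyclotomic_four_rat, map_add, map_pow, map_one, toLaurent_X_eq_lq, add_comm]

theorem cyc_six : cyc 6 = 1 - lq + lq ^ 2 := by
  simp only [cyc, cyclotomic_six, map_add, map_sub, map_pow, map_one, toLaurent_X_eq_lq]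
  ring

theorem cyc_eight : cyc 8 = 1 + lq ^ 4 := by
  simp only [cyc, cyclotomic_eight_rat, map_add, map_pow, map_one, toLaurent_X_eq_lq, add_comm]

theorem cyc_twelve : cyc 12 = 1 - lq ^ 2 + lq ^ 4 := by
  simp only [cyc, cyclotomic_twelve_rat, map_add, map_sub, map_pow, map_one, toLaurent_X_eq_lq]
  ring

end Homology

/-- Homology of the weighted complex for the Coxeter system of type `F₄` (generators indexed by `0,1,2,3` corresponding to `1,2,3,4`). -/
theorem homology_F4 {W : Type*} [Group W] {Mat : CoxeterMatrix (Fin 4)}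
    (cs : CoxeterSystem Mat W)
    (h12 : Mat.M 0 1 = 3) (h23 : Mat.M 1 2 = 4) (h34 : Mat.M 2 3 = 3)
    (h13 : Mat.M 0 2 = 2) (h14 : Mat.M 0 3 = 2) (h24 : Mat.M 1 3 = 2) :
    Nonempty (Hgy cs 0 ≃ₗ[R] (CycQuot 2)) ∧
    Nonempty (Hgy cs 1 ≃ₗ[R] (CycQuot 2)) ∧
    Nonempty (Hgy cs 2 ≃ₗ[R] (CycQuot 2 × CycQuot 3 × CycQuot 6)) ∧
    Nonempty (Hgy cs 3 ≃ₗ[R] (CycQuot 2 × CycQuot 3 × CycQuot 4 × CycQuot 6 × CycQuot 8 × CycQuot 12)) ∧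
    (∀ k, 4 ≤ k → Subsingleton (Hgy cs k)) := by
  have hM : ∀ i j, Mat.M i j = coxF4 i j := by
    have h21 := (Mat.symmetric 1 0).trans h12
    have h32 := (Mat.symmetric 2 1).trans h23
    have h43 := (Mat.symmetric 3 2).trans h34
    have h31 := (Mat.symmetric 2 0).trans h13
    have h41 := (Mat.symmetric 3 0).trans h14
    have h42 := (Mat.symmetric 3 1).trans h24
    intro i j
    fin_cases i <;> fin_cases j <;> first | exact Mat.diagonal _ | assumption
  have self : ∀ n, Nonempty ((R ⧸ Ideal.span {cyc n}) ≃ₗ[R] CycQuot n) :=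
    fun n => ⟨LinearEquiv.refl R _⟩
  have hc : ∀ m n : ℕ, m ≠ n → IsCoprime (cyc m) (cyc n) := fun _ _ h => isCoprime_cyc h
  refine ⟨?_, ?_, ?_, ?_, fun k hk => subsingleton_Hgy cs hM hk⟩
  · have h := nonempty_Hgy_zero cs hM
    rw [← cyc_two] at h
    exact h
  · have h := nonempty_Hgy_one cs hM
    rw [← cyc_two] at h
    exact h
  · obtain ⟨e⟩ := nonempty_Hgy_two cs hM
    have hf : (1 + lq + lq ^ 2 + lq ^ 3 + lq ^ 4 + lq ^ 5 : R) = cyc 2 * (cyc 3 * cyc 6) := by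
      rw [cyc_two, cyc_three, cyc_six]
      ring
    rw [hf] at e
    obtain ⟨e'⟩ := nonempty_quotient_mul_equiv
      ((hc 2 3 (by decide)).mul_right (hc 2 6 (by decide)))
      (nonempty_quotient_mul_equiv (hc 3 6 (by decide)) (self 6))
    exact ⟨e.trans e'⟩
  · obtain ⟨e⟩ := nonempty_Hgy_three cs hM
    have hf : ratioF4 = cyc 2 * (cyc 3 * (cyc 4 * (cyc 6 * (cyc 8 * cyc 12)))) := by
      rw [ratioF4, cyc_two, cyc_three, cyc_four, cyc_six, cyc_eight, cyc_twelve]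
      ring
    rw [hf] at e
    obtain ⟨e'⟩ := nonempty_quotient_mul_equiv
      ((hc 2 3 (by decide)).mul_right ((hc 2 4 (by decide)).mul_right
        ((hc 2 6 (by decide)).mul_right ((hc 2 8 (by decide)).mul_right (hc 2 12 (by decide))))))
      (nonempty_quotient_mul_equiv
        ((hc 3 4 (by decide)).mul_right ((hc 3 6 (by decide)).mul_right
          ((hc 3 8 (by decide)).mul_right (hc 3 12 (by decide)))))
        (nonempty_quotient_mul_equiv
          ((hc 4 6 (by decide)).mul_right ((hc 4 8 (by decide)).mul_right (hc 4 12 (by decide))))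
          (nonempty_quotient_mul_equiv ((hc 6 8 (by decide)).mul_right (hc 6 12 (by decide)))
            (nonempty_quotient_mul_equiv (hc 8 12 (by decide)) (self 12)))))
    exact ⟨e.trans e'⟩
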